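/- arXiv:2401.16602 — 2 statements merged into one kernel-verified Lean document; each statement's English description precedes it below -/
import Mathlib

section
/- Let k be a field of characteristic ≠ 2 equipped with a non-empty set V of non-trivial discrete valuations with respect to which the local-global principle for isometry holds. Let q be an I^n-neighbor of complementary dimension r over k for some n ≥ 1. Then q satisfies LGP((dim q + r − 2^n)/2 + 1, (dim q − r)/2) with respect to V. -/
/-!  Diagonal quadratic forms over a field of characteristic ≠ 2.
In characteristic ≠ 2 every regular quadratic form is isometric to a diagonal form
`⟨d 1, …, d n⟩`, so we model (regular) quadratic forms by their diagonal
coefficient functions. -/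

/-- The diagonal quadratic form `⟨d i⟩_{i : ι}` over `k`. -/
noncomputable def diagQF (k : Type) [Field k] {ι : Type} [Fintype ι] (d : ι → k) :
    QuadraticForm k (ι → k) :=
  QuadraticMap.weightedSumSquares k d

/-- Isometry of (diagonal) quadratic forms. -/
def FormIsom (k : Type) [Field k] {ι κ : Type} [Fintype ι] [Fintype κ]
    (d : ι → k) (e : κ → k) : Prop :=
  QuadraticMap.Equivalent (diagQF k d) (diagQF k e)

/-- The orthogonal sum of `m` copies of the hyperbolic plane `⟨1, -1⟩`. -/
def hypForm (k : Type) [Field k] (m : ℕ) : Fin (2 * m) → k :=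
  fun j => if j.val % 2 = 0 then 1 else -1

/-- The Witt index of a (diagonal) form: the largest `m` such that the form is isometric
to `m·ℍ ⟂ (rest)` for some diagonal form `rest`. -/
noncomputable def wittIndex (k : Type) [Field k] {ι : Type} [Fintype ι] (d : ι → k) : ℕ :=
  sSup {m : ℕ | ∃ (s : ℕ) (e : Fin s → k), FormIsom k d (Sum.elim (hypForm k m) e)}
/-- The value group of (normalized) discrete valuations. -/
abbrev Zm0 : Type := WithZero (Multiplicative ℤ)

/-- A (discrete, i.e. `ℤₘ₀`-valued) valuation is non-trivial if it takes a value other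
than 0 and 1. -/
def isNontrivialVal {k : Type} [Field k] (v : Valuation k Zm0) : Prop :=
  ∃ x : k, v x ≠ 0 ∧ v x ≠ 1

/-- The completion `k_v` of a field `k` with respect to a discrete valuation `v`. -/
noncomputable def valCompletion {k : Type} [Field k] (v : Valuation k Zm0) : Type :=
  letI := Valued.mk' v
  UniformSpace.Completion k

noncomputable instance valCompletion.instField {k : Type} [Field k] (v : Valuation k Zm0) :
    Field (valCompletion v) :=
  letI := Valued.mk' v
  UniformSpace.Completion.instField

/-- The canonical embedding of a field into its `v`-adic completion. -/
noncomputable def toValCompletion {k : Type} [Field k] (v : Valuation k Zm0) :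
    k →+* valCompletion v :=
  letI := Valued.mk' v
  UniformSpace.Completion.coeRingHom

/-- A quadratic form `q` over `k` satisfies `LGP(r, s)` with respect to a set `V` of
discrete valuations on `k` if `i_W(q_{k_v}) ≥ r` for all `v ∈ V` implies `i_W(q) ≥ s`. -/
def satisfiesLGP {k : Type} [Field k] (V : Set (Valuation k Zm0)) {ι : Type} [Fintype ι]
    (d : ι → k) (r s : ℕ) : Prop :=
  (∀ v ∈ V, r ≤ wittIndex (valCompletion v) (toValCompletion v ∘ d)) → s ≤ wittIndex k d
/-- Witt equivalence of (diagonal) quadratic forms: the two forms become isometric after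
adding suitable numbers of hyperbolic planes. -/
def wittEquiv (k : Type) [Field k] {ι κ : Type} [Fintype ι] [Fintype κ]
    (d : ι → k) (e : κ → k) : Prop :=
  ∃ a b : ℕ, FormIsom k (Sum.elim d (hypForm k a)) (Sum.elim e (hypForm k b))

/-- The Witt class of a (diagonal) form lies in `I^n(k)`, the `n`-th power of the
fundamental ideal of the Witt ring: equivalently (since `I^n(k)` is additively generated
by the `n`-fold Pfister forms, and `-⟨⟨a₁,…,aₙ⟩⟩ = ⟨-1⟩·⟨⟨a₁,…,aₙ⟩⟩` in the Witt ring),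
the form is Witt equivalent to an orthogonal sum of scaled `n`-fold Pfister forms
`c_s · ⟨⟨a_{s,1}, …, a_{s,n}⟩⟩`.  The diagonal entries of `⟨⟨a₁,…,aₙ⟩⟩` are indexed by
the subsets `S ⊆ {1,…,n}`, with entry `∏_{u ∈ S} a_u`. -/
def inIpow (k : Type) [Field k] (n : ℕ) {ι : Type} [Fintype ι] (d : ι → k) : Prop :=
  ∃ (t : ℕ) (c : Fin t → k) (a : Fin t → Fin n → k),
    (∀ s, c s ≠ 0) ∧ (∀ s u, a s u ≠ 0) ∧
    wittEquiv k d (fun p : Fin t × Finset (Fin n) => c p.1 * ∏ u ∈ p.2, a p.1 u)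

/-- `q` is an `I^n`-neighbor of complementary dimension `r`: there exists an
`r`-dimensional (regular) form `σ` with `0 ≤ r < dim q` such that the Witt class of
`q ⟂ σ` lies in `I^n(k)`. -/
def isIneighbor (k : Type) [Field k] (n : ℕ) {m : ℕ} (d : Fin m → k) (r : ℕ) : Prop :=
  r < m ∧ ∃ σ : Fin r → k, (∀ t, σ t ≠ 0) ∧ inIpow k n (Sum.elim d σ)

section P1
variable {K : Type} [Field K]

theorem diagQF_apply {ι : Type} [Fintype ι] (d : ι → K) (x : ι → K) :
    diagQF K d x = ∑ i, d i * (x i * x i) := by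
  simp [diagQF, QuadraticMap.weightedSumSquares_apply]

theorem formIsom_iff {ι κ : Type} [Fintype ι] [Fintype κ] (d : ι → K) (e : κ → K) :
    FormIsom K d e ↔ ∃ f : (ι → K) ≃ₗ[K] (κ → K),
      ∀ x, ∑ j, e j * (f x j * f x j) = ∑ i, d i * (x i * x i) := by
  constructor
  · rintro ⟨f⟩
    refine ⟨f.toLinearEquiv, fun x => ?_⟩
    have := f.map_app x
    rw [diagQF_apply, diagQF_apply] at this
    exact this
  · rintro ⟨f, hf⟩
    exact ⟨{ f with map_app' := fun x => by rw [diagQF_apply, diagQF_apply]; exact hf x }⟩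

theorem FormIsom.rfl' {ι : Type} [Fintype ι] (d : ι → K) : FormIsom K d d :=
  QuadraticMap.Equivalent.refl _

theorem FormIsom.symm' {ι κ : Type} [Fintype ι] [Fintype κ] {d : ι → K} {e : κ → K}
    (h : FormIsom K d e) : FormIsom K e d := QuadraticMap.Equivalent.symm h

theorem FormIsom.trans' {ι κ μ : Type} [Fintype ι] [Fintype κ] [Fintype μ] {d : ι → K} {e : κ → K}
    {c : μ → K} (h : FormIsom K d e) (h' : FormIsom K e c) : FormIsom K d c :=
  QuadraticMap.Equivalent.trans h h'

theorem FormIsom.card_eq {ι κ : Type} [Fintype ι] [Fintype κ] {d : ι → K} {e : κ → K}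
    (h : FormIsom K d e) : Fintype.card ι = Fintype.card κ := by
  rw [formIsom_iff] at h
  obtain ⟨f, -⟩ := h
  simpa using f.finrank_eq

theorem FormIsom.reindex {ι κ : Type} [Fintype ι] [Fintype κ] (e : κ → K) (σ : ι ≃ κ) :
    FormIsom K (e ∘ σ) e := by
  rw [formIsom_iff]
  refine ⟨LinearEquiv.funCongrLeft K K σ.symm, fun x => ?_⟩
  rw [← σ.sum_comp]
  simp [LinearEquiv.funCongrLeft_apply, LinearMap.funLeft_apply]

theorem FormIsom.sum {ι κ ι' κ' : Type} [Fintype ι] [Fintype κ] [Fintype ι'] [Fintype κ']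
    {d : ι → K} {e : κ → K} {d' : ι' → K} {e' : κ' → K}
    (h : FormIsom K d e) (h' : FormIsom K d' e') :
    FormIsom K (Sum.elim d d') (Sum.elim e e') := by
  rw [formIsom_iff] at *
  obtain ⟨f, hf⟩ := h
  obtain ⟨f', hf'⟩ := h'
  refine ⟨(LinearEquiv.sumArrowLequivProdArrow ι ι' K K).trans
    ((f.prodCongr f').trans (LinearEquiv.sumArrowLequivProdArrow κ κ' K K).symm), fun x => ?_⟩
  have h1 := hf (fun i => x (Sum.inl i))
  have h2 := hf' (fun i => x (Sum.inr i))
  simp only [Fintype.sum_sum_type, Sum.elim_inl, Sum.elim_inr]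
  rw [← h1, ← h2]
  rfl

theorem exists_equiv_of_map_eq {α ι κ : Type} [Fintype ι] [Fintype κ] {d : ι → α} {e : κ → α}
    (h : Finset.univ.val.map d = Finset.univ.val.map e) : ∃ σ : ι ≃ κ, d = e ∘ σ := by
  classical
  have hc : ∀ y, Nonempty ({i // d i = y} ≃ {j // e j = y}) := by
    intro y
    rw [← Fintype.card_eq, Fintype.card_subtype, Fintype.card_subtype]
    have := congrArg (Multiset.count y) h
    rw [Multiset.count_map, Multiset.count_map] at this
    simp only [Finset.card, Finset.filter]
    convert this using 3 <;> exact eq_comm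
  have τ := fun y => (hc y).some
  refine ⟨(Equiv.sigmaFiberEquiv d).symm.trans
    ((Equiv.sigmaCongrRight τ).trans (Equiv.sigmaFiberEquiv e)), ?_⟩
  funext i
  simp only [Function.comp, Equiv.trans_apply]
  have : (Equiv.sigmaFiberEquiv d).symm i = ⟨d i, i, rfl⟩ := rfl
  rw [this]
  exact ((τ (d i)) ⟨i, rfl⟩).2.symm

/-- entries -/
def ent {α ι : Type} [Fintype ι] (d : ι → α) : Multiset α := Finset.univ.val.map d

theorem exists_ent {α : Type} (s : Multiset α) : ∃ d : Fin s.card → α, ent d = s := by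
  induction s using Quotient.inductionOn with
  | h l =>
    refine ⟨fun i : Fin l.length => l.get i, ?_⟩
    exact (Fin.univ_val_map _).trans (congrArg _ (List.ofFn_get l))

theorem ent_sum {α ι κ : Type} [Fintype ι] [Fintype κ] (d : ι → α) (e : κ → α) :
    ent (Sum.elim d e) = ent d + ent e := by
  unfold ent
  have : (Finset.univ : Finset (ι ⊕ κ)) = Finset.univ.disjSum Finset.univ := rfl
  rw [this]
  simp [Finset.disjSum, Multiset.disjSum, Multiset.map_map, Function.comp_def]

variable (K) in
def isoCon : AddCon (Multiset K) where
  r s t := ∃ (ι κ : Type) (_ : Fintype ι) (_ : Fintype κ) (d : ι → K) (e : κ → K),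
    ent d = s ∧ ent e = t ∧ FormIsom K d e
  iseqv := {
    refl := fun s => by
      obtain ⟨d, hd⟩ := exists_ent s
      exact ⟨_, _, _, _, d, d, hd, hd, FormIsom.rfl' d⟩
    symm := by
      rintro s t ⟨ι, κ, _, _, d, e, h1, h2, h⟩
      exact ⟨κ, ι, _, _, e, d, h2, h1, h.symm'⟩
    trans := by
      rintro s t u ⟨ι, κ, _, _, d, e, h1, h2, h⟩ ⟨ι', κ', _, _, d', e', h1', h2', h'⟩
      obtain ⟨σ, hσ⟩ := exists_equiv_of_map_eq (h2.trans h1'.symm)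
      exact ⟨ι, κ', _, _, d, e', h1, h2', h.trans' ((hσ ▸ FormIsom.reindex d' σ).trans' h')⟩ }
  add' := by
    rintro s t u w ⟨ι, κ, _, _, d, e, rfl, rfl, h⟩ ⟨ι', κ', _, _, d', e', rfl, rfl, h'⟩
    exact ⟨_, _, _, _, _, _, ent_sum d d', ent_sum e e', h.sum h'⟩

variable (K) in
abbrev GW : Type := (isoCon K).Quotient

def gg (a : K) : GW K := (isoCon K).mk' {a}

def cls {ι : Type} [Fintype ι] (d : ι → K) : GW K := ∑ i, gg (d i)

theorem cls_eq_mk {ι : Type} [Fintype ι] (d : ι → K) : cls d = (isoCon K).mk' (ent d) := by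
  have : ent d = ∑ i, {d i} := by
    unfold ent
    rw [← Multiset.sum_map_singleton (Multiset.map d _), Multiset.map_map]; rfl
  rw [this, map_sum]; rfl

theorem cls_eq_iff {ι κ : Type} [Fintype ι] [Fintype κ] (d : ι → K) (e : κ → K) :
    cls d = cls e ↔ FormIsom K d e := by
  rw [cls_eq_mk, cls_eq_mk]
  constructor
  · intro h
    obtain ⟨ι', κ', _, _, d', e', h1, h2, h⟩ := (AddCon.eq _).1 h
    obtain ⟨σ, rfl⟩ := exists_equiv_of_map_eq h1
    obtain ⟨τ, rfl⟩ := exists_equiv_of_map_eq h2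
    exact (FormIsom.reindex d σ).symm'.trans' (h.trans' (FormIsom.reindex e τ))
  · intro h
    exact (AddCon.eq _).2 ⟨_, _, _, _, d, e, rfl, rfl, h⟩

theorem cls_sum {ι κ : Type} [Fintype ι] [Fintype κ] (d : ι → K) (e : κ → K) :
    cls (Sum.elim d e) = cls d + cls e := by
  simp [cls, Fintype.sum_sum_type]

theorem exists_cls (x : GW K) : ∃ (n : ℕ) (d : Fin n → K), cls d = x := by
  induction x using AddCon.induction_on with
  | H s =>
    obtain ⟨d, hd⟩ := exists_ent s
    exact ⟨_, d, by rw [cls_eq_mk, hd]; rfl⟩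

/-- lift: a map K → L carrying isometric families to isometric families -/
def gwLift {L : Type} [Field L] (φ : K → L)
    (h : ∀ (ι κ : Type) (_ : Fintype ι) (_ : Fintype κ) (d : ι → K) (e : κ → K),
      FormIsom K d e → FormIsom L (φ ∘ d) (φ ∘ e)) : GW K →+ GW L :=
  AddCon.lift (isoCon K) (((isoCon L).mk').comp (Multiset.mapAddMonoidHom φ)) (by
    rintro s t ⟨ι, κ, _, _, d, e, rfl, rfl, hh⟩
    have := (cls_eq_iff _ _).2 (h _ _ _ _ _ _ hh)
    rw [cls_eq_mk, cls_eq_mk] at this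
    simpa [AddCon.ker_rel, ent] using this)

theorem gwLift_gg {L : Type} [Field L] (φ : K → L) (h) (a : K) : gwLift φ h (gg a) = gg (φ a) := by
  simp only [gwLift, gg, AddCon.lift_mk']
  simp

theorem gwLift_cls {L : Type} [Field L] (φ : K → L) (h) {ι : Type} [Fintype ι] (d : ι → K) :
    gwLift φ h (cls d) = cls (φ ∘ d) := by
  simp [cls, gwLift_gg]

def gdim : GW K →+ ℕ :=
  AddCon.lift (isoCon K) (Multiset.cardHom) (by
    rintro s t ⟨ι, κ, _, _, d, e, rfl, rfl, hh⟩
    simpa [AddCon.ker_rel, ent] using hh.card_eq)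

theorem gdim_gg (a : K) : gdim (gg a) = 1 := by
  simp only [gdim, gg, AddCon.lift_mk']
  simp

theorem gdim_cls {ι : Type} [Fintype ι] (d : ι → K) : gdim (cls d) = Fintype.card ι := by
  simp [cls, gdim_gg]

end P1

set_option linter.unusedSimpArgs false
set_option linter.deprecated false
set_option linter.unnecessarySimpa false
section P2
variable {K : Type} [Field K]

/-- diagonal bilinear form -/
def bb {ι : Type} [Fintype ι] (d : ι → K) (x y : ι → K) : K := ∑ i, d i * (x i * y i)

section bbl
variable {ι : Type} [Fintype ι] (d : ι → K)
theorem bb_add_left (x y z : ι → K) : bb d (x + y) z = bb d x z + bb d y z := by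
  simp only [bb, ← Finset.sum_add_distrib]
  exact Finset.sum_congr rfl fun i _ => by simp; ring
theorem bb_smul_left (c : K) (x z : ι → K) : bb d (c • x) z = c * bb d x z := by
  simp only [bb, Finset.mul_sum]
  exact Finset.sum_congr rfl fun i _ => by simp; ring
theorem bb_comm (x z : ι → K) : bb d x z = bb d z x := by
  simp only [bb]
  exact Finset.sum_congr rfl fun i _ => by ring
theorem bb_add_right (x y z : ι → K) : bb d z (x + y) = bb d z x + bb d z y := by
  rw [bb_comm, bb_add_left, bb_comm, bb_comm d y]
theorem bb_smul_right (c : K) (x z : ι → K) : bb d z (c • x) = c * bb d z x := by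
  rw [bb_comm, bb_smul_left, bb_comm]
theorem bb_sub_right (x y z : ι → K) : bb d z (x - y) = bb d z x - bb d z y := by
  rw [sub_eq_add_neg, bb_add_right, ← neg_one_smul K y, bb_smul_right]; ring
theorem bb_sub_left (x y z : ι → K) : bb d (x - y) z = bb d x z - bb d y z := by
  rw [bb_comm, bb_sub_right, bb_comm, bb_comm d y]
theorem bb_single [DecidableEq ι] (i : ι) (x : ι → K) : bb d (Pi.single i 1) x = d i * x i := by
  rw [bb, Finset.sum_eq_single i]
  · simp
  · intro j _ hj; simp [hj]
  · simp
end bbl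

theorem bb_of_isom (h2 : (2 : K) ≠ 0) {ι κ : Type} [Fintype ι] [Fintype κ] {d : ι → K} {e : κ → K}
    (f : (ι → K) ≃ₗ[K] (κ → K)) (hf : ∀ x, bb e (f x) (f x) = bb d x x) (x y : ι → K) :
    bb e (f x) (f y) = bb d x y := by
  have h := hf (x + y)
  rw [map_add] at h
  simp only [bb_add_left, bb_add_right, hf, bb_comm e (f y) (f x), bb_comm d y x] at h
  have : (2 : K) * (bb e (f x) (f y) - bb d x y) = 0 := by linear_combination h
  rcases mul_eq_zero.1 this with h | h
  · exact absurd h h2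
  · exact sub_eq_zero.1 h

theorem formIsom_iff' {ι κ : Type} [Fintype ι] [Fintype κ] (d : ι → K) (e : κ → K) :
    FormIsom K d e ↔ ∃ f : (ι → K) ≃ₗ[K] (κ → K), ∀ x, bb e (f x) (f x) = bb d x x :=
  formIsom_iff d e

/-- reflections -/
theorem exists_reflection {ι : Type} [Fintype ι] (d : ι → K) (v : ι → K)
    (hv : bb d v v ≠ 0) : ∃ f : (ι → K) ≃ₗ[K] (ι → K), (∀ x, bb d (f x) (f x) = bb d x x) ∧
      ∀ x, f x = x - (2 * bb d v x / bb d v v) • v := by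
  let φ : Module.Dual K (ι → K) :=
    { toFun := fun x => 2 * bb d v x / bb d v v
      map_add' := fun x y => by rw [bb_add_right]; ring
      map_smul' := fun c x => by rw [bb_smul_right]; simp; ring }
  have hφ : φ v = 2 := by
    change 2 * bb d v v / bb d v v = 2
    field_simp
  refine ⟨Module.reflection hφ, fun x => ?_, fun x => ?_⟩
  · rw [Module.reflection_apply]
    change bb d (x - (2 * bb d v x / bb d v v) • v) (x - (2 * bb d v x / bb d v v) • v) = _
    simp only [bb_sub_left, bb_sub_right, bb_smul_left, bb_smul_right, bb_comm d x v]
    field_simp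
    ring
  · rw [Module.reflection_apply]; rfl

theorem exists_isom_moving (h2 : (2 : K) ≠ 0) {ι : Type} [Fintype ι] (d : ι → K) (u w : ι → K)
    (hu : bb d u u ≠ 0) (huw : bb d u u = bb d w w) :
    ∃ f : (ι → K) ≃ₗ[K] (ι → K), (∀ x, bb d (f x) (f x) = bb d x x) ∧ f u = w := by
  by_cases h : bb d (u - w) (u - w) = 0
  · have h' : bb d (u + w) (u + w) = 4 * bb d u u := by
      simp only [bb_sub_left, bb_sub_right, bb_add_left, bb_add_right, bb_comm d w u, ← huw] at h ⊢
      linear_combination -h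
    have h4 : bb d (u + w) (u + w) ≠ 0 := by
      rw [h', show (4 : K) = 2 * 2 by norm_num]
      exact mul_ne_zero (mul_ne_zero h2 h2) hu
    obtain ⟨f, hf, hf'⟩ := exists_reflection d (u + w) h4
    refine ⟨f.trans (LinearEquiv.neg K), fun x => ?_, ?_⟩
    · rw [← hf x]
      simp [bb]
    · have : 2 * bb d (u + w) u / bb d (u + w) (u + w) = 1 := by
        rw [div_eq_one_iff_eq h4]
        simp only [bb_sub_left, bb_sub_right, bb_add_left, bb_add_right, bb_comm d w u, ← huw]
        ring
      simp [hf', this]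
  · obtain ⟨f, hf, hf'⟩ := exists_reflection d (u - w) h
    refine ⟨f, hf, ?_⟩
    have : 2 * bb d (u - w) u / bb d (u - w) (u - w) = 1 := by
      rw [div_eq_one_iff_eq h]
      simp only [bb_sub_left, bb_sub_right, bb_add_left, bb_add_right, bb_comm d w u, ← huw]
      ring
    simp [hf', this]

theorem bb_sum_elim {ι κ : Type} [Fintype ι] [Fintype κ] (d : ι → K) (e : κ → K) (x y : ι ⊕ κ → K) :
    bb (Sum.elim d e) x y = bb d (x ∘ Sum.inl) (y ∘ Sum.inl) + bb e (x ∘ Sum.inr) (y ∘ Sum.inr) := by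
  simp [bb, Fintype.sum_sum_type]

theorem witt_cancel (h2 : (2 : K) ≠ 0) {ι κ : Type} [Fintype ι] [Fintype κ] (d : ι → K) (e : κ → K)
    (a : K) (ha : a ≠ 0)
    (h : FormIsom K (Sum.elim (fun _ : Unit => a) d) (Sum.elim (fun _ : Unit => a) e)) :
    FormIsom K d e := by
  classical
  rw [formIsom_iff'] at h
  obtain ⟨f, hf⟩ := h
  have key : ∀ (μ : Type) [Fintype μ] [DecidableEq μ] (c : μ → K) (x : Unit ⊕ μ → K),
      bb (Sum.elim (fun _ : Unit => a) c) (Pi.single (Sum.inl ()) 1) x = a * x (Sum.inl ()) :=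
    fun μ _ _ c x => by rw [bb_single]; simp
  have hu := hf (Pi.single (Sum.inl ()) 1)
  rw [key ι] at hu
  simp only [Pi.single_eq_same, mul_one] at hu
  obtain ⟨g, hg, hgu⟩ := exists_isom_moving h2 (Sum.elim (fun _ : Unit => a) e)
    (f (Pi.single (Sum.inl ()) 1)) (Pi.single (Sum.inl ()) 1) (by rw [hu]; exact ha)
    (by rw [hu, key]; simp)
  let F := f.trans g
  have hF : ∀ x, bb (Sum.elim (fun _ : Unit => a) e) (F x) (F x) =
      bb (Sum.elim (fun _ : Unit => a) d) x x := fun x => by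
    rw [← hf x]; exact hg _
  have hFu : F (Pi.single (Sum.inl ()) 1) = Pi.single (Sum.inl ()) 1 := hgu
  have hb := bb_of_isom h2 F hF
  have h0 : ∀ x, F x (Sum.inl ()) = x (Sum.inl ()) := by
    intro x
    have := hb (Pi.single (Sum.inl ()) 1) x
    rw [hFu, key, key] at this
    exact mul_left_cancel₀ ha this
  have hform : ∀ x, x (Sum.inl ()) = 0 → F x = Sum.elim (fun _ => 0) (fun j => F x (Sum.inr j)) := by
    intro x hx
    funext j
    rcases j with j | j
    · simp [h0, hx]
    · rfl
  have h0' : ∀ x, F.symm x (Sum.inl ()) = x (Sum.inl ()) := by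
    intro x
    rw [← h0 (F.symm x)]; simp
  have hform' : ∀ x, x (Sum.inl ()) = 0 →
      F.symm x = Sum.elim (fun _ => 0) (fun j => F.symm x (Sum.inr j)) := by
    intro x hx
    funext j
    rcases j with j | j
    · simp [h0', hx]
    · rfl
  have hadd : ∀ (μ : Type) (x y : μ → K), (Sum.elim (fun _ : Unit => (0 : K)) (x + y)) =
      Sum.elim (fun _ : Unit => (0 : K)) x + Sum.elim (fun _ : Unit => (0 : K)) y := by
    intro μ x y; funext j; rcases j with j | j <;> simp
  have hsmul : ∀ (μ : Type) (c : K) (y : μ → K), (Sum.elim (fun _ : Unit => (0 : K)) (c • y)) =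
      c • Sum.elim (fun _ : Unit => (0 : K)) y := by
    intro μ x y; funext j; rcases j with j | j <;> simp
  rw [formIsom_iff']
  refine ⟨{
    toFun := fun x j => F (Sum.elim (fun _ => 0) x) (Sum.inr j)
    invFun := fun x j => F.symm (Sum.elim (fun _ => 0) x) (Sum.inr j)
    map_add' := fun x y => by rw [hadd, map_add]; rfl
    map_smul' := fun x y => by rw [hsmul, map_smul]; rfl
    left_inv := fun x => by
      simp only
      rw [← hform _ rfl]; simp
    right_inv := fun x => by
      simp only
      rw [← hform' _ rfl]; simp }, fun x => ?_⟩
  have h1 := hF (Sum.elim (fun _ => 0) x)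
  rw [hform _ rfl] at h1
  rw [bb_sum_elim, bb_sum_elim] at h1
  simpa [bb] using h1

theorem gg_add_cancel (h2 : (2 : K) ≠ 0) {a : K} (ha : a ≠ 0) {x y : GW K}
    (h : gg a + x = gg a + y) : x = y := by
  obtain ⟨n, d, rfl⟩ := exists_cls x
  obtain ⟨m, e, rfl⟩ := exists_cls y
  rw [cls_eq_iff]
  refine witt_cancel h2 d e a ha ?_
  rw [← cls_eq_iff, cls_sum, cls_sum]
  simpa [cls] using h

theorem formIsom_map {L : Type} [Field L] (φ : K →+* L) (h2 : (2 : K) ≠ 0)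
    {ι κ : Type} [Fintype ι] [Fintype κ] (d : ι → K) (e : κ → K)
    (h : FormIsom K d e) : FormIsom L (φ ∘ d) (φ ∘ e) := by
  classical
  rw [formIsom_iff'] at *
  obtain ⟨f, hf⟩ := h
  have hb := bb_of_isom h2 f hf
  let P := LinearMap.toMatrix' f.toLinearMap
  let Q := LinearMap.toMatrix' f.symm.toLinearMap
  have hPQ : P * Q = 1 := by
    simp only [P, Q, ← LinearMap.toMatrix'_comp]; simp
  have hQP : Q * P = 1 := by
    simp only [P, Q, ← LinearMap.toMatrix'_comp]; simp
  have hPQ' : P.map φ * Q.map φ = 1 := by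
    rw [← Matrix.map_mul, hPQ]; simp
  have hQP' : Q.map φ * P.map φ = 1 := by
    rw [← Matrix.map_mul, hQP]; simp
  have hP : P.transpose * Matrix.diagonal e * P = Matrix.diagonal d := by
    ext i j
    have := hb (Pi.single i 1) (Pi.single j 1)
    rw [bb_single] at this
    rw [Matrix.mul_apply, Matrix.diagonal_apply]
    simp only [Matrix.mul_diagonal, Matrix.transpose_apply]
    rw [bb] at this
    have hP1 : ∀ i j, P j i = f (Pi.single i 1) j := by
      intro i j
      simp [P, LinearMap.toMatrix'_apply]
    simp only [hP1]
    rw [show (if i = j then d i else 0) = d i * (Pi.single j 1 : ι → K) i by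
      by_cases hij : i = j <;> simp [hij], ← this]
    exact Finset.sum_congr rfl fun _ _ => by ring
  have hP' : (P.map φ).transpose * Matrix.diagonal (φ ∘ e) * P.map φ = Matrix.diagonal (φ ∘ d) := by
    have := congrArg (fun M => M.map φ) hP
    simp only [Matrix.map_mul] at this
    rw [Matrix.diagonal_map (map_zero φ), Matrix.diagonal_map (map_zero φ)] at this
    exact this
  have hbb : ∀ (μ : Type) [Fintype μ] [DecidableEq μ] (c x y : μ → L),
      bb c x y = x ⬝ᵥ (Matrix.diagonal c).mulVec y := by
    intro μ _ _ c x y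
    simp only [bb, dotProduct, Matrix.mulVec_diagonal]
    exact Finset.sum_congr rfl fun _ _ => by ring
  refine ⟨LinearEquiv.ofLinear (Matrix.toLin' (P.map φ)) (Matrix.toLin' (Q.map φ)) ?_ ?_, fun x => ?_⟩
  · rw [← Matrix.toLin'_mul, hPQ']; simp
  · rw [← Matrix.toLin'_mul, hQP']; simp
  · simp only [LinearEquiv.ofLinear_apply, Matrix.toLin'_apply]
    rw [hbb, hbb, ← hP', Matrix.mul_assoc, ← Matrix.mulVec_mulVec, ← Matrix.mulVec_mulVec,
      Matrix.dotProduct_mulVec x, Matrix.vecMul_transpose]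

def gmap {L : Type} [Field L] (φ : K →+* L) (h2 : (2 : K) ≠ 0) : GW K →+ GW L :=
  gwLift φ (fun _ _ _ _ _ _ h => formIsom_map φ h2 _ _ h)

theorem gmap_gg {L : Type} [Field L] (φ : K →+* L) (h2 : (2 : K) ≠ 0) (a : K) :
    gmap φ h2 (gg a) = gg (φ a) := gwLift_gg _ _ _

theorem gmap_cls {L : Type} [Field L] (φ : K →+* L) (h2 : (2 : K) ≠ 0) {ι : Type} [Fintype ι]
    (d : ι → K) : gmap φ h2 (cls d) = cls (φ ∘ d) := gwLift_cls _ _ _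

/-- scaling -/
def gsc (c : K) : GW K →+ GW K :=
  gwLift (fun x => c * x) (fun ι κ _ _ d e h => by
    rw [formIsom_iff] at *
    obtain ⟨f, hf⟩ := h
    refine ⟨f, fun x => ?_⟩
    have := congrArg (c * ·) (hf x)
    simp only [Finset.mul_sum, ← mul_assoc] at this
    simpa [← mul_assoc] using this)

theorem gsc_gg (c a : K) : gsc c (gg a) = gg (c * a) := gwLift_gg _ _ _

theorem gsc_gsc (c b : K) (x : GW K) : gsc c (gsc b x) = gsc (c * b) x := by
  obtain ⟨n, d, rfl⟩ := exists_cls x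
  simp [cls, gsc_gg, mul_assoc]

theorem gsc_one (x : GW K) : gsc 1 x = x := by
  obtain ⟨n, d, rfl⟩ := exists_cls x
  simp [cls, gsc_gg]

theorem gg_sq (a x : K) (hx : x ≠ 0) : gg (a * x ^ 2) = gg a := by
  have : FormIsom K (fun _ : Unit => a * x ^ 2) (fun _ : Unit => a) := by
    rw [formIsom_iff]
    refine ⟨LinearEquiv.smulOfNeZero K _ x hx, fun y => ?_⟩
    simp
    ring
  rw [← cls_eq_iff] at this
  simpa [cls] using this

theorem gg_add (a b : K) (h : a + b ≠ 0) : gg a + gg b = gg (a + b) + gg (a * b * (a + b)) := by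
  have : FormIsom K (Sum.elim (fun _ : Unit => a + b) (fun _ : Unit => a * b * (a + b)))
      (Sum.elim (fun _ : Unit => a) (fun _ : Unit => b)) := by
    rw [formIsom_iff]
    refine ⟨{
      toFun := fun x => Sum.elim (fun _ => x (Sum.inl ()) + b * x (Sum.inr ()))
        (fun _ => x (Sum.inl ()) - a * x (Sum.inr ()))
      invFun := fun y => Sum.elim (fun _ => (a * y (Sum.inl ()) + b * y (Sum.inr ())) / (a + b))
        (fun _ => (y (Sum.inl ()) - y (Sum.inr ())) / (a + b))
      map_add' := fun x y => by
        funext j; rcases j with j | j <;> simp <;> ring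
      map_smul' := fun c y => by
        funext j; rcases j with j | j <;> simp <;> ring
      left_inv := fun x => by
        funext j; rcases j with j | j <;> simp <;> field_simp <;> ring
      right_inv := fun x => by
        funext j; rcases j with j | j <;> simp <;> field_simp <;> ring }, fun x => ?_⟩
    simp
    ring
  rw [← cls_eq_iff, cls_sum, cls_sum] at this
  simpa [cls] using this.symm

variable (K) in
def HH : GW K := gg 1 + gg (-1)

theorem gg_add_neg (h2 : (2 : K) ≠ 0) (a : K) (ha : a ≠ 0) : gg a + gg (-a) = HH K := by
  by_cases h1 : a = 1
  · subst h1; rfl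
  by_cases h1' : a = -1
  · subst h1'; rw [neg_neg, add_comm]; rfl
  have hx : (a⁻¹ + 1) / 2 ≠ 0 := by
    refine div_ne_zero (fun h => h1' ?_) h2
    field_simp at h
    linear_combination h
  have hy : (a⁻¹ - 1) / 2 ≠ 0 := by
    refine div_ne_zero (fun h => h1 ?_) h2
    field_simp at h
    linear_combination -h
  have e1 : a * ((a⁻¹ + 1) / 2) ^ 2 + -a * ((a⁻¹ - 1) / 2) ^ 2 = 1 := by
    field_simp
    ring
  have := gg_add (a * ((a⁻¹ + 1) / 2) ^ 2) (-a * ((a⁻¹ - 1) / 2) ^ 2) (by rw [e1]; exact one_ne_zero)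
  rw [e1, gg_sq _ _ hx, gg_sq _ _ hy] at this
  rw [this, HH]
  congr 1
  rw [← gg_sq (-1) (a * ((a⁻¹ + 1) / 2) * ((a⁻¹ - 1) / 2)) (mul_ne_zero (mul_ne_zero ha hx) hy)]
  congr 1
  ring

theorem gsc_HH (h2 : (2 : K) ≠ 0) (a : K) (ha : a ≠ 0) : gsc a (HH K) = HH K := by
  rw [HH, map_add, gsc_gg, gsc_gg, mul_one, mul_neg_one, gg_add_neg h2 a ha]; rfl

theorem HH_cancel (h2 : (2 : K) ≠ 0) (n : ℕ) {x y : GW K} (h : n • HH K + x = n • HH K + y) :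
    x = y := by
  induction n with
  | zero => simpa using h
  | succ n ih =>
    rw [succ_nsmul', add_assoc, add_assoc, HH, add_assoc, add_assoc] at h
    exact ih (gg_add_cancel h2 (neg_ne_zero.2 one_ne_zero) (gg_add_cancel h2 one_ne_zero h))

theorem gdim_HH : gdim (HH K) = 2 := by
  rw [HH, map_add, gdim_gg, gdim_gg]

theorem cls_hypForm (m : ℕ) : cls (hypForm K m) = m • HH K := by
  induction m with
  | zero => simp [cls]
  | succ m ih =>
    rw [succ_nsmul, ← ih]
    unfold cls
    have : ∀ f : Fin (2 * (m + 1)) → GW K, ∑ i, f i = ∑ i : Fin (2 * m + 2), f i := fun f => rfl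
    rw [this, Fin.sum_univ_castSucc, Fin.sum_univ_castSucc, add_assoc]
    congr 1
    have h1 : (2 * m + 1) % 2 = 1 := by omega
    simp [hypForm, HH, h1]

theorem cls_cons {n : ℕ} (a : K) (e : Fin n → K) :
    cls (Fin.cons a e : Fin (n + 1) → K) = gg a + cls e := by
  unfold cls
  rw [Fin.sum_univ_succ]
  simp only [Fin.cons_zero, Fin.cons_succ]

theorem split_aux {ι : Type} [DecidableEq ι] (d : ι → K) (hd : ∀ i, d i ≠ 0) (x : ι → K) (S : Finset ι) :
    ∀ a : K, a ≠ 0 → ∑ i ∈ S, d i * (x i * x i) = a → ∃ (n : ℕ) (e : Fin n → K), (∀ i, e i ≠ 0) ∧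
      n + 1 = S.card ∧ ∑ i ∈ S, gg (d i) = gg a + cls e := by
  induction S using Finset.induction_on with
  | empty => intro a ha h; simp at h; exact absurd h.symm ha
  | insert i S hi ih =>
    intro a ha h
    rw [Finset.sum_insert hi] at h
    rw [Finset.sum_insert hi, Finset.card_insert_of_notMem hi]
    by_cases hb : ∑ i ∈ S, d i * (x i * x i) = 0
    · rw [hb, add_zero] at h
      have hx : x i ≠ 0 := by
        rintro h0
        rw [h0] at h; simp at h; exact ha h.symm
      refine ⟨S.card, fun j => d (S.equivFin.symm j), fun j => hd _, rfl, ?_⟩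
      congr 1
      · rw [← h, ← pow_two, gg_sq _ _ hx]
      · rw [cls, S.equivFin.symm.sum_comp (fun j => gg (d j)), Finset.sum_coe_sort S (fun j => gg (d j))]
    · obtain ⟨n, e, he, hn, hS⟩ := ih _ hb rfl
      set b := ∑ i ∈ S, d i * (x i * x i) with hbdef
      rw [hS]
      by_cases hx : x i = 0
      · rw [hx] at h
        have hab : b = a := by simpa using h
        refine ⟨n + 1, Fin.cons (d i) e, ?_, by omega, ?_⟩
        · intro j; refine Fin.cases ?_ (fun j => ?_) j
          · exact hd i
          · exact he j
        · rw [cls_cons, ← hab]; abel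
      · have := gg_add (d i * x i ^ 2) b (by rw [pow_two, h]; exact ha)
        rw [gg_sq _ _ hx, pow_two, h] at this
        refine ⟨n + 1, Fin.cons (d i * (x i * x i) * b * a) e, ?_, by omega, ?_⟩
        · intro j; refine Fin.cases ?_ (fun j => ?_) j
          · exact mul_ne_zero (mul_ne_zero (mul_ne_zero (hd i) (mul_ne_zero hx hx)) hb) ha
          · exact he j
        · rw [← add_assoc, this, cls_cons]; abel

theorem split {ι : Type} [Fintype ι] (d : ι → K) (hd : ∀ i, d i ≠ 0) (x : ι → K)
    (a : K) (ha : a ≠ 0) (h : bb d x x = a) : ∃ (n : ℕ) (e : Fin n → K), (∀ i, e i ≠ 0) ∧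
      n + 1 = Fintype.card ι ∧ cls d = gg a + cls e := by
  classical
  exact split_aux d hd x Finset.univ a ha h

def Aniso {ι : Type} [Fintype ι] (d : ι → K) : Prop := ∀ x, bb d x x = 0 → x = 0

theorem Aniso.ne_zero {ι : Type} [Fintype ι] {d : ι → K} (h : Aniso d) (i : ι) : d i ≠ 0 := by
  classical
  intro hi
  have := h (Pi.single i 1) (by rw [bb_single, hi, zero_mul])
  simpa using congrFun this i

theorem split_iso (h2 : (2 : K) ≠ 0) {ι : Type} [Fintype ι] (d : ι → K) (hd : ∀ i, d i ≠ 0)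
    (h : ¬ Aniso d) : ∃ (n : ℕ) (e : Fin n → K), (∀ i, e i ≠ 0) ∧
      n + 2 = Fintype.card ι ∧ cls d = HH K + cls e := by
  classical
  simp only [Aniso, not_forall] at h
  obtain ⟨x, hx, hx0⟩ := h
  obtain ⟨i, hi⟩ := Function.ne_iff.1 hx0
  simp only [Pi.zero_apply] at hi
  rw [bb, ← Finset.add_sum_erase _ _ (Finset.mem_univ i)] at hx
  obtain ⟨n, e, he, hn, hS⟩ := split_aux d hd (fun j => x j / x i) (Finset.univ.erase i) (- d i)
    (neg_ne_zero.2 (hd i)) (by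
      have : ∀ j, d j * (x j / x i * (x j / x i)) = (d j * (x j * x j)) / (x i * x i) := by
        intro j; field_simp
      simp only [this]
      rw [← Finset.sum_div, eq_neg_of_add_eq_zero_right hx]
      field_simp)
  refine ⟨n, e, he, ?_, ?_⟩
  · rw [Finset.card_erase_of_mem (Finset.mem_univ i)] at hn
    have : 0 < Fintype.card ι := Fintype.card_pos_iff.2 ⟨i⟩
    rw [Finset.card_univ] at hn
    omega
  · rw [cls, ← Finset.add_sum_erase _ _ (Finset.mem_univ i), hS, ← add_assoc, gg_add_neg h2 _ (hd i)]

theorem ne_zero_of_isom (h2 : (2 : K) ≠ 0) {ι κ : Type} [Fintype ι] [Fintype κ] {d : ι → K} {e : κ → K}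
    (h : FormIsom K d e) (hd : ∀ i, d i ≠ 0) (j : κ) : e j ≠ 0 := by
  classical
  intro hj
  rw [formIsom_iff'] at h
  obtain ⟨f, hf⟩ := h
  have hb := bb_of_isom h2 f hf
  have : f.symm (Pi.single j 1) = 0 := by
    funext i
    have := hb (Pi.single i 1) (f.symm (Pi.single j 1))
    rw [bb_single, LinearEquiv.apply_symm_apply, bb_comm, bb_single, hj, zero_mul] at this
    simpa [hd i] using this.symm
  have h0 : (Pi.single j 1 : κ → K) = 0 := by simpa using this
  simpa using congrFun h0 j

theorem represents_of_isom {ι κ : Type} [Fintype ι] [Fintype κ] {d : ι → K} {e : κ → K}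
    (h : cls d = cls e) {a : K} (hx : ∃ x, bb d x x = a) : ∃ x, bb e x x = a := by
  rw [cls_eq_iff, formIsom_iff'] at h
  obtain ⟨f, hf⟩ := h
  obtain ⟨x, hx⟩ := hx
  exact ⟨f x, by rw [hf, hx]⟩

theorem aniso_of_isom {ι κ : Type} [Fintype ι] [Fintype κ] {d : ι → K} {e : κ → K}
    (h : cls d = cls e) (hd : Aniso d) : Aniso e := by
  rw [cls_eq_iff, formIsom_iff'] at h
  obtain ⟨f, hf⟩ := h
  intro y hy
  have := hd (f.symm y) (by rw [← hf]; simpa using hy)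
  simpa using this

end P2

section P3
open Polynomial
variable {K : Type} [Field K]

/-- polynomial version -/
theorem coeff_qp {ι : Type} [Fintype ι] (d : ι → K) (f : ι → K[X]) (D : ℕ)
    (hf : ∀ i, (f i).natDegree ≤ D) :
    (∑ i, C (d i) * (f i * f i)).coeff (D + D) = bb d (fun i => (f i).coeff D) (fun i => (f i).coeff D) := by
  rw [finsetSum_coeff, bb]
  refine Finset.sum_congr rfl fun i _ => ?_
  rw [coeff_C_mul, coeff_mul_add_eq_of_natDegree_le (hf i) (hf i)]

theorem exists_top {ι : Type} [Fintype ι] (f : ι → K[X]) (hf : f ≠ 0) : ∃ D,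
    (∀ i, (f i).natDegree ≤ D) ∧ ∃ i, (f i).coeff D ≠ 0 := by
  classical
  obtain ⟨i, hi⟩ := Function.ne_iff.1 hf
  obtain ⟨j, hj, hj'⟩ := Finset.exists_max_image (Finset.univ.filter (fun i => f i ≠ 0)) (fun i => (f i).natDegree)
    ⟨i, by simpa using hi⟩
  refine ⟨(f j).natDegree, fun i => ?_, j, ?_⟩
  · by_cases h : f i = 0
    · simp [h]
    · exact hj' i (by simpa using h)
  · simpa using hj

theorem aniso_top {ι : Type} [Fintype ι] {d : ι → K} (hd : Aniso d) (f : ι → K[X]) (hf : f ≠ 0) :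
    ∃ D, (∀ i, (f i).natDegree ≤ D) ∧ (∑ i, C (d i) * (f i * f i)).coeff (D + D) ≠ 0 := by
  obtain ⟨D, h1, i, h2⟩ := exists_top f hf
  refine ⟨D, h1, ?_⟩
  rw [coeff_qp d f D h1]
  intro h
  exact h2 (congrFun (hd _ h) i)

theorem aniso_poly {ι : Type} [Fintype ι] {d : ι → K} (hd : Aniso d) (f : ι → K[X])
    (h : ∑ i, C (d i) * (f i * f i) = 0) : f = 0 := by
  by_contra hf
  obtain ⟨D, _, h2⟩ := aniso_top hd f hf
  rw [h] at h2
  simp at h2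

theorem cassels_pfister {ι : Type} [Fintype ι] {d : ι → K} (hd : Aniso d) (p : K[X]) :
    ∀ (N : ℕ) (g : K[X]) (f : ι → K[X]), g.natDegree ≤ N → g ≠ 0 →
      ∑ i, C (d i) * (f i * f i) = p * g ^ 2 → ∃ f' : ι → K[X], ∑ i, C (d i) * (f' i * f' i) = p := by
  intro N
  induction N using Nat.strong_induction_on with
  | _ N ih =>
    intro g f hgN hg hfg
    by_cases hr : (fun i => f i % g) = 0
    · refine ⟨fun i => f i / g, ?_⟩
      have : ∀ i, f i = g * (f i / g) := by
        intro i
        have h1 := EuclideanDomain.div_add_mod (f i) g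
        rw [show f i % g = 0 from congrFun hr i, add_zero] at h1
        exact h1.symm
      have h3 : (∑ i, C (d i) * (f i / g * (f i / g))) * g ^ 2 = p * g ^ 2 := by
        rw [← hfg, Finset.sum_mul]
        refine Finset.sum_congr rfl fun i _ => ?_
        conv_rhs => rw [this i]
        ring
      exact mul_right_cancel₀ (pow_ne_zero 2 hg) h3
    · let v : ι → K[X] := fun i => f i / g
      let r : ι → K[X] := fun i => f i % g
      have hfr : ∀ i, f i = g * v i + r i := fun i => (EuclideanDomain.div_add_mod (f i) g).symm
      let Qv := ∑ i, C (d i) * (v i * v i)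
      let Bfv := ∑ i, C (d i) * (f i * v i)
      let a := Qv - p
      let b := 2 * (p * g - Bfv)
      let g' := a * g + b
      have hQr : ∑ i, C (d i) * (r i * r i) = g * g' := by
        have : ∑ i, C (d i) * (r i * r i) = (∑ i, C (d i) * (f i * f i)) - 2 * g * Bfv + g ^ 2 * Qv := by
          simp only [Bfv, Qv, Finset.mul_sum]
          rw [← Finset.sum_sub_distrib, ← Finset.sum_add_distrib]
          refine Finset.sum_congr rfl fun i _ => ?_
          rw [show r i = f i - g * v i by rw [hfr i]; ring]
          ring
        rw [this, hfg]
        simp only [g', a, b]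
        ring
      have hf' : ∑ i, C (d i) * ((a * f i + b * v i) * (a * f i + b * v i)) = p * g' ^ 2 := by
        have : ∑ i, C (d i) * ((a * f i + b * v i) * (a * f i + b * v i)) =
            a ^ 2 * (∑ i, C (d i) * (f i * f i)) + 2 * a * b * Bfv + b ^ 2 * Qv := by
          simp only [Bfv, Qv, Finset.mul_sum]
          rw [← Finset.sum_add_distrib, ← Finset.sum_add_distrib]
          refine Finset.sum_congr rfl fun i _ => ?_
          ring
        rw [this, hfg]
        simp only [g', a, b]
        ring
      obtain ⟨D, hD, hD'⟩ := aniso_top hd r hr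
      have hne : ∑ i, C (d i) * (r i * r i) ≠ 0 := by
        intro h; rw [h] at hD'; simp at hD'
      have hg' : g' ≠ 0 := by
        rintro h; rw [h, mul_zero] at hQr; exact hne hQr
      have hrdeg : ∀ i, (r i).natDegree ≤ g.natDegree - 1 := by
        intro i
        by_cases h0 : g.natDegree = 0
        · obtain ⟨c, hc⟩ := natDegree_eq_zero.1 h0
          have : r i = 0 := by
            refine EuclideanDomain.mod_eq_zero.2 ?_
            rw [← hc]
            have : c ≠ 0 := by rintro rfl; simp at hc; exact hg hc.symm
            exact (isUnit_C.2 (isUnit_iff_ne_zero.2 this)).dvd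
          simp [this]
        · have := natDegree_mod_lt (f i) h0
          change (f i % g).natDegree ≤ _
          omega
      have hg0 : g.natDegree ≠ 0 := by
        intro h0
        obtain ⟨c, hc⟩ := natDegree_eq_zero.1 h0
        apply hr
        funext i
        refine EuclideanDomain.mod_eq_zero.2 ?_
        rw [← hc]
        have : c ≠ 0 := by rintro rfl; simp at hc; exact hg hc.symm
        exact (isUnit_C.2 (isUnit_iff_ne_zero.2 this)).dvd
      have hdeg : (∑ i, C (d i) * (r i * r i)).natDegree ≤ (g.natDegree - 1) + (g.natDegree - 1) := by
        refine natDegree_sum_le_of_forall_le _ _ fun i _ => ?_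
        refine (natDegree_C_mul_le _ _).trans (natDegree_mul_le.trans ?_)
        have := hrdeg i
        omega
      rw [hQr, natDegree_mul hg hg'] at hdeg
      exact ih (g'.natDegree) (by omega) g' _ le_rfl hg' hf'

theorem clear_denoms {ι : Type} [Fintype ι] (d : ι → K) (w : ι → FractionRing K[X]) :
    ∃ (g : K[X]) (f : ι → K[X]), g ≠ 0 ∧
      (∀ i, algebraMap K[X] (FractionRing K[X]) (f i) = algebraMap _ _ g * w i) ∧
      algebraMap K[X] (FractionRing K[X]) (∑ i, C (d i) * (f i * f i)) =
        bb ((algebraMap K[X] (FractionRing K[X])).comp C ∘ d) w w * algebraMap _ _ g ^ 2 := by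
  obtain ⟨b, hb⟩ := IsLocalization.exist_integer_multiples_of_finite (nonZeroDivisors K[X]) w
  choose f hf using hb
  have hf' : ∀ i, algebraMap K[X] (FractionRing K[X]) (f i) = algebraMap _ _ (b : K[X]) * w i := by
    intro i
    rw [hf i, Algebra.smul_def]
  refine ⟨b, f, nonZeroDivisors.ne_zero b.2, hf', ?_⟩
  rw [map_sum, bb, Finset.sum_mul]
  refine Finset.sum_congr rfl fun i _ => ?_
  rw [map_mul, map_mul, hf']
  simp only [Function.comp, RingHom.comp_apply]
  ring

theorem aniso_frac {ι : Type} [Fintype ι] {d : ι → K} (hd : Aniso d) :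
    Aniso ((algebraMap K[X] (FractionRing K[X])).comp C ∘ d) := by
  intro w hw
  obtain ⟨g, f, hg, hf, h⟩ := clear_denoms d w
  rw [hw, zero_mul] at h
  have h0 := aniso_poly hd f (IsFractionRing.injective K[X] (FractionRing K[X]) (by rw [h, map_zero]))
  funext i
  have := hf i
  rw [h0] at this
  simp only [Pi.zero_apply, map_zero] at this
  rcases mul_eq_zero.1 this.symm with h | h
  · exact absurd ((map_eq_zero_iff _ (IsFractionRing.injective K[X] (FractionRing K[X]))).1 h) hg
  · exact h

theorem cassels_frac {ι : Type} [Fintype ι] {d : ι → K} (hd : Aniso d) (p : K[X])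
    (w : ι → FractionRing K[X])
    (hw : bb ((algebraMap K[X] (FractionRing K[X])).comp C ∘ d) w w = algebraMap _ _ p) :
    ∃ f' : ι → K[X], ∑ i, C (d i) * (f' i * f' i) = p := by
  obtain ⟨g, f, hg, hf, h⟩ := clear_denoms d w
  rw [hw, ← map_pow, ← map_mul] at h
  exact cassels_pfister hd p _ g f le_rfl hg (IsFractionRing.injective K[X] (FractionRing K[X]) h)

/-- degree two polynomials -/
theorem cassels_two (h2 : (2 : K) ≠ 0) {ι : Type} [Fintype ι] {d : ι → K} (hd : Aniso d) (a e : K)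
    (w : ι → FractionRing K[X])
    (hw : bb ((algebraMap K[X] (FractionRing K[X])).comp C ∘ d) w w =
      algebraMap _ _ (C e + C a * X ^ 2)) :
    ∃ u v : ι → K, bb d u u = a ∧ bb d u v = 0 ∧ bb d v v = e := by
  obtain ⟨f, hf⟩ := cassels_frac hd _ w hw
  have hdeg : ∀ i, (f i).natDegree ≤ 1 := by
    by_cases h0 : f = 0
    · simp [h0]
    obtain ⟨D, h1, h3⟩ := aniso_top hd f h0
    intro i
    refine (h1 i).trans ?_
    by_contra hD
    apply h3
    rw [hf]
    simp only [coeff_add, coeff_C_mul, coeff_X_pow, coeff_C]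
    rw [if_neg (by omega), if_neg (by omega)]
    simp
  have hfi : ∀ i, f i = C ((f i).coeff 1) * X + C ((f i).coeff 0) := fun i =>
    eq_X_add_C_of_natDegree_le_one (hdeg i)
  have hexp : ∑ i, C (d i) * (f i * f i) =
      C (bb d (fun i => (f i).coeff 1) (fun i => (f i).coeff 1)) * X ^ 2 +
      C (2 * bb d (fun i => (f i).coeff 1) (fun i => (f i).coeff 0)) * X +
      C (bb d (fun i => (f i).coeff 0) (fun i => (f i).coeff 0)) := by
    simp only [bb, map_sum, map_mul, Finset.sum_mul, Finset.mul_sum]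
    rw [← Finset.sum_add_distrib, ← Finset.sum_add_distrib]
    refine Finset.sum_congr rfl fun i _ => ?_
    conv_lhs => rw [hfi i]
    rw [show (C 2 : K[X]) = 2 from rfl]
    ring
  rw [hexp] at hf
  refine ⟨fun i => (f i).coeff 1, fun i => (f i).coeff 0, ?_, ?_, ?_⟩
  · have := congrArg (fun q => coeff q 2) hf
    simpa [coeff_X, coeff_C] using this
  · have := congrArg (fun q => coeff q 1) hf
    simp only [coeff_add, coeff_C_mul, coeff_X_pow, coeff_C, coeff_X] at this
    norm_num at this
    exact this.resolve_left h2
  · have := congrArg (fun q => coeff q 0) hf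
    simpa [coeff_X, coeff_C] using this
end P3

section P4
open Polynomial

theorem bb_cons {K : Type} [Field K] {n : ℕ} (a : K) (d : Fin n → K) (x y : Fin (n + 1) → K) :
    bb (Fin.cons a d : Fin (n + 1) → K) x y =
      a * (x 0 * y 0) + bb d (fun i => x i.succ) (fun i => y i.succ) := by
  unfold bb
  rw [Fin.sum_univ_succ]
  simp only [Fin.cons_zero, Fin.cons_succ]

theorem comp_cons' {K L : Type} [Field K] [Field L] (φ : K →+* L) {n : ℕ} (a : K) (d : Fin n → K) :
    (φ ∘ (Fin.cons a d : Fin (n + 1) → K)) = (Fin.cons (φ a) (φ ∘ d) : Fin (n + 1) → L) := by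
  funext i
  refine Fin.cases ?_ (fun i => ?_) i
  · rfl
  · rfl

/-- an anisotropic form that does not represent a -/
theorem aniso_cons_neg {K : Type} [Field K] {n : ℕ} {d : Fin n → K} (hd : Aniso d) (a : K)
    (h : ¬ ∃ x, bb d x x = a) : Aniso (Fin.cons (-a) d : Fin (n + 1) → K) := by
  intro x hx
  rw [bb_cons] at hx
  by_cases h0 : x 0 = 0
  · rw [h0] at hx
    have := hd (fun i => x i.succ) (by simpa using hx)
    funext i
    refine Fin.cases ?_ (fun i => ?_) i
    · exact h0
    · exact congrFun this i
  · exfalso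
    apply h
    refine ⟨(x 0)⁻¹ • (fun i => x i.succ), ?_⟩
    rw [bb_smul_left, bb_smul_right]
    have : bb d (fun i => x i.succ) (fun i => x i.succ) = a * (x 0 * x 0) := by linear_combination hx
    rw [this]
    field_simp

theorem aniso_tail {K : Type} [Field K] {n : ℕ} {d : Fin n → K} {a : K}
    (h : Aniso (Fin.cons a d : Fin (n + 1) → K)) : Aniso d := by
  intro x hx
  have := h (Fin.cons 0 x) (by rw [bb_cons]; simpa using hx)
  funext i
  exact congrFun this i.succ

theorem generic (N : ℕ) : ∀ (F : Type) [Field F] (_ : (2 : F) ≠ 0) (a : Fin N → F),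
    (∀ j, a j ≠ 0) →
    ∃ (L : Type) (_ : Field L) (φ : F →+* L) (x : Fin N → L), (∀ j, x j ≠ 0) ∧
      (∀ (m : ℕ) (d : Fin m → F), Aniso d → Aniso (φ ∘ d)) ∧
      ∀ (m : ℕ) (d : Fin m → F), Aniso d → ∀ w, bb (φ ∘ d) w w = ∑ j, φ (a j) * (x j * x j) → N ≤ m := by
  induction N with
  | zero =>
    intro F _ h2 a ha
    exact ⟨F, inferInstance, RingHom.id F, fun _ => 1, fun _ => one_ne_zero,
      fun m d hd => hd, fun m d hd w hw => Nat.zero_le _⟩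
  | succ N ih =>
    intro F _ h2 a ha
    obtain ⟨L, _, φ, x, hx, hA, hB⟩ := ih F h2 (fun j => a j.succ) (fun j => ha _)
    have h2L : (2 : L) ≠ 0 := by
      have := (map_ne_zero φ).2 h2
      rwa [map_ofNat] at this
    let al := algebraMap L[X] (FractionRing L[X])
    let ψ : L →+* FractionRing L[X] := al.comp C
    refine ⟨FractionRing L[X], inferInstance, ψ.comp φ, Fin.cons (al X) (ψ ∘ x), ?_, ?_, ?_⟩
    · intro j
      refine Fin.cases ?_ (fun j => ?_) j
      · rw [Fin.cons_zero]
        exact (map_ne_zero_iff _ (IsFractionRing.injective L[X] (FractionRing L[X]))).2 X_ne_zero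
      · rw [Fin.cons_succ]
        exact (map_ne_zero ψ).2 (hx j)
    · intro m d hd
      exact aniso_frac (hA m d hd)
    · intro m d hd w hw
      set e : L := ∑ j, φ (a j.succ) * (x j * x j) with he
      have hval : ∑ j, (ψ.comp φ) (a j) * ((Fin.cons (al X) (ψ ∘ x) : Fin (N + 1) → FractionRing L[X]) j *
          (Fin.cons (al X) (ψ ∘ x) : Fin (N + 1) → FractionRing L[X]) j) =
          al (C e + C (φ (a 0)) * X ^ 2) := by
        rw [Fin.sum_univ_succ]
        simp only [Fin.cons_zero, Fin.cons_succ]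
        rw [he, map_add, add_comm, map_sum, map_sum]
        congr 1
        · refine Finset.sum_congr rfl fun j _ => ?_
          simp [ψ]
        · simp only [ψ, RingHom.comp_apply, map_mul, map_pow]; ring
      rw [hval] at hw
      obtain ⟨u, v, huu, huv, hvv⟩ := cassels_two h2L (hA m d hd) (φ (a 0)) e w hw
      have hrep : ∃ y, bb d y y = a 0 := by
        by_contra hno
        have h1 := hA _ _ (aniso_cons_neg hd (a 0) hno)
        rw [comp_cons'] at h1
        have h3 := h1 (Fin.cons 1 u) (by
          rw [bb_cons]
          simp only [Fin.cons_zero, Fin.cons_succ, huu, map_neg]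
          ring)
        have := congrFun h3 0
        simp at this
      obtain ⟨y, hy⟩ := hrep
      obtain ⟨n, d', hd', hn, hcls⟩ := split d hd.ne_zero y (a 0) (ha 0) hy
      rw [← cls_cons] at hcls
      have hc := aniso_of_isom hcls hd
      have hclsL := congrArg (gmap (ψ.comp φ) h2) hcls
      rw [gmap_cls, gmap_cls] at hclsL
      obtain ⟨w', hw'⟩ := represents_of_isom hclsL ⟨w, hw⟩
      obtain ⟨u, v, huu, huv, hvv⟩ := cassels_two h2L (hA _ _ hc) (φ (a 0)) e w' hw'
      rw [comp_cons', bb_cons] at huu huv hvv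
      have hx0 : ∃ x0 : L, (u 0 * x0 + v 0) * (u 0 * x0 + v 0) = x0 * x0 := by
        by_cases h : u 0 = 1
        · refine ⟨- v 0 / 2, ?_⟩
          rw [h]; field_simp; ring
        · have h' : 1 - u 0 ≠ 0 := sub_ne_zero.2 (Ne.symm h)
          refine ⟨v 0 / (1 - u 0), ?_⟩
          field_simp; ring
      obtain ⟨x0, hx0⟩ := hx0
      have := hB n d' (aniso_tail hc) (x0 • (fun i => u i.succ) + (fun i => v i.succ)) (by
        simp only [bb_add_left, bb_add_right, bb_smul_left, bb_smul_right]
        have hcm := bb_comm (φ ∘ d') (fun i : Fin n => v i.succ) (fun i : Fin n => u i.succ)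
        linear_combination x0 ^ 2 * huu + 2 * x0 * huv + hvv - φ (a 0) * hx0 + x0 * hcm)
      rw [Fintype.card_fin] at hn
      omega
end P4

section P5
variable {K : Type} [Field K]

theorem gsc_mul_sq (c y : K) (hy : y ≠ 0) (x : GW K) : gsc (c * y ^ 2) x = gsc c x := by
  obtain ⟨n, d, rfl⟩ := exists_cls x
  simp only [cls, map_sum, gsc_gg]
  refine Finset.sum_congr rfl fun i _ => ?_
  rw [← gg_sq (c * d i) y hy]
  congr 1; ring

theorem gsc_add (b c : K) (h : b + c ≠ 0) (x : GW K) :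
    gsc b x + gsc c x = gsc (b + c) x + gsc (b * c * (b + c)) x := by
  obtain ⟨n, d, rfl⟩ := exists_cls x
  simp only [cls, map_sum, gsc_gg]
  rw [← Finset.sum_add_distrib, ← Finset.sum_add_distrib]
  refine Finset.sum_congr rfl fun i _ => ?_
  by_cases h0 : d i = 0
  · simp [h0]
  · rw [gg_add (b * d i) (c * d i) (by rw [← add_mul]; exact mul_ne_zero h h0)]
    rw [← gg_sq (b * c * (b + c) * d i) (d i) h0]
    congr 2 <;> ring

theorem gsc_nsmul_HH (h2 : (2 : K) ≠ 0) (a : K) (ha : a ≠ 0) (h : ℕ) :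
    gsc a (h • HH K) = h • HH K := by
  rw [map_nsmul, gsc_HH h2 a ha]

section
variable {ι : Type} (a : ι → K)

def pp (T : Finset ι) : K := ∏ u ∈ T, a u

def RR (S : Finset ι) : GW K := ∑ T ∈ S.powerset, gg (pp a T)

theorem pp_ne (ha : ∀ i, a i ≠ 0) (T : Finset ι) : pp a T ≠ 0 :=
  Finset.prod_ne_zero_iff.2 fun i _ => ha i

theorem RR_insert [DecidableEq ι] (S : Finset ι) (i : ι) (hi : i ∉ S) :
    RR a (insert i S) = RR a S + gsc (a i) (RR a S) := by
  unfold RR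
  rw [Finset.sum_powerset_insert hi, map_sum]
  congr 1
  refine Finset.sum_congr rfl fun T hT => ?_
  have : i ∉ T := fun h => hi (Finset.mem_powerset.1 hT h)
  rw [gsc_gg, pp, pp, Finset.prod_insert this]

def vv (S : Finset ι) (x : Finset ι → K) : K := ∑ T ∈ S.powerset, pp a T * (x T * x T)

theorem vv_insert [DecidableEq ι] (S : Finset ι) (i : ι) (hi : i ∉ S) (x : Finset ι → K) :
    vv a (insert i S) x = vv a S x + a i * vv a S (fun T => x (insert i T)) := by
  unfold vv
  rw [Finset.sum_powerset_insert hi, Finset.mul_sum]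
  congr 1
  refine Finset.sum_congr rfl fun T hT => ?_
  have : i ∉ T := fun h => hi (Finset.mem_powerset.1 hT h)
  rw [pp, pp, Finset.prod_insert this]
  ring

theorem vv_zero (S : Finset ι) (x : Finset ι → K) (h : ∀ T ∈ S.powerset, x T = 0) : vv a S x = 0 :=
  Finset.sum_eq_zero fun T hT => by rw [h T hT]; simp

theorem RR_neg (h2 : (2 : K) ≠ 0) (ha : ∀ i, a i ≠ 0) (S : Finset ι) :
    RR a S + gsc (-1) (RR a S) = S.powerset.card • HH K := by
  unfold RR
  rw [map_sum, ← Finset.sum_add_distrib, ← Finset.sum_const]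
  refine Finset.sum_congr rfl fun T _ => ?_
  rw [gsc_gg, neg_one_mul, gg_add_neg h2 _ (pp_ne a ha T)]

theorem pfister (h2 : (2 : K) ≠ 0) (ha : ∀ i, a i ≠ 0) (S : Finset ι) :
    (∀ x, vv a S x ≠ 0 → gsc (vv a S x) (RR a S) = RR a S) ∧
    (∀ x, vv a S x = 0 → (∃ T ∈ S.powerset, x T ≠ 0) → ∃ h : ℕ, RR a S = h • HH K) := by
  classical
  induction S using Finset.induction_on with
  | empty =>
    have hv : ∀ x, vv a ∅ x = 1 * x ∅ ^ 2 := by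
      intro x; simp [vv, pp]; ring
    constructor
    · intro x hx
      rw [hv] at hx ⊢
      rw [gsc_mul_sq _ _ (by rintro h; simp [h] at hx), gsc_one]
    · rintro x hx ⟨T, hT, hxT⟩
      rw [hv] at hx
      simp at hT
      subst hT
      simp [hxT] at hx
  | insert i S hi ih =>
    obtain ⟨rd, hy⟩ := ih
    rw [RR_insert a S i hi]
    by_cases hno : ∃ h : ℕ, RR a S = h • HH K
    · obtain ⟨h, hh⟩ := hno
      rw [hh, gsc_nsmul_HH h2 _ (ha i), ← add_smul]
      exact ⟨fun x hx => gsc_nsmul_HH h2 _ hx _, fun x _ _ => ⟨_, rfl⟩⟩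
    · have hz : ∀ x, vv a S x = 0 → ∀ T ∈ S.powerset, x T = 0 := by
        intro x hx T hT
        by_contra hT'
        exact hno (hy x hx ⟨T, hT, hT'⟩)
      constructor
      · intro x hx
        rw [vv_insert a S i hi] at hx ⊢
        set X := vv a S x
        set Y := vv a S (fun T => x (insert i T)) with hY
        have rY : Y ≠ 0 → gsc Y (RR a S) = RR a S := rd _
        have rX : X ≠ 0 → gsc X (RR a S) = RR a S := rd _
        by_cases hX0 : X = 0
        · rw [hX0, zero_add] at hx ⊢
          have hY0 : Y ≠ 0 := right_ne_zero_of_mul hx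
          rw [map_add, ← gsc_gsc, ← gsc_gsc, rY hY0, add_comm, gsc_gsc Y, mul_comm Y,
            ← gsc_gsc (a i) Y, rY hY0, gsc_gsc]
          congr 1
          have := gsc_mul_sq 1 (a i) (ha i) (RR a S)
          rw [gsc_one, one_mul] at this
          rw [← pow_two, this]
        · by_cases hY0 : Y = 0
          · rw [hY0, mul_zero, add_zero] at hx ⊢
            rw [map_add, gsc_gsc, mul_comm, ← gsc_gsc, rX hX0]
          · have e1 : RR a S + gsc (a i) (RR a S) = gsc X (RR a S) + gsc (a i * Y) (RR a S) := by
              rw [rX hX0, ← gsc_gsc, rY hY0]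
            have e2 := gsc_add X (a i * Y) hx (RR a S)
            rw [← e1] at e2
            have e3 : gsc (X * (a i * Y) * (X + a i * Y)) (RR a S) =
                gsc (X + a i * Y) (gsc (a i) (RR a S)) := by
              rw [gsc_gsc, show X * (a i * Y) * (X + a i * Y) = ((X + a i * Y) * a i) * (X * Y) by ring,
                ← gsc_gsc _ (X * Y), ← gsc_gsc X Y, rY hY0, rX hX0]
            rw [e3, ← map_add] at e2
            exact e2.symm
      · rintro x hx ⟨T, hT, hxT⟩
        rw [vv_insert a S i hi] at hx
        set X := vv a S x with hX
        set Y := vv a S (fun T => x (insert i T)) with hY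
        by_cases hY0 : Y = 0
        · exfalso
          rw [hY0, mul_zero, add_zero] at hx
          have z1 := hz _ hx
          have z2 := hz _ hY0
          rw [Finset.powerset_insert, Finset.mem_union] at hT
          rcases hT with hT | hT
          · exact hxT (z1 T hT)
          · obtain ⟨T', hT', rfl⟩ := Finset.mem_image.1 hT
            exact hxT (z2 T' hT')
        · have hX' : a i * Y = -1 * X := by linear_combination hx
          have hX0 : X ≠ 0 := by
            rintro h
            rw [h, mul_zero] at hX'
            exact mul_ne_zero (ha i) hY0 hX'
          refine ⟨S.powerset.card, ?_⟩
          · have e1 : gsc (a i) (RR a S) = gsc (-1) (RR a S) := by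
              have : gsc (a i) (gsc Y (RR a S)) = gsc (-1) (gsc X (RR a S)) := by
                rw [gsc_gsc, gsc_gsc, hX']
              rwa [rd _ hX0, rd _ hY0] at this
            rw [e1]
            exact RR_neg a h2 ha S
end
end P5

section P6

theorem cls_elim_one {K : Type} [Field K] (h : ℕ) :
    cls (Sum.elim (fun _ : Fin h => (1 : K)) (fun _ : Fin h => (-1 : K))) = h • HH K := by
  rw [cls_sum]
  simp [cls, HH, nsmul_add]

theorem quad {L : Type} [Field L] (h2 : (2 : L) ≠ 0) (δ : L) [Fact (∀ r : L, r ^ 2 ≠ δ + 0 * r)]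
    {M : ℕ} (d : Fin M → L) (hd : Aniso d) (h : ℕ)
    (hh : cls (algebraMap L (QuadraticAlgebra L δ 0) ∘ d) = h • HH (QuadraticAlgebra L δ 0))
    (i : Fin M) : ∃ w : Fin M → L, w i = 0 ∧ bb d w w = -δ * d i := by
  have hδ : δ ≠ 0 := by
    have := (Fact.out : ∀ r : L, r ^ 2 ≠ δ + 0 * r) 0
    rintro rfl
    simp at this
  rw [← cls_elim_one, cls_eq_iff] at hh
  have hM := hh.card_eq
  simp only [Fintype.card_fin, Fintype.card_sum] at hM
  rw [formIsom_iff'] at hh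
  obtain ⟨f, hf⟩ := hh
  have hre : ∀ z : Fin M → QuadraticAlgebra L δ 0,
      (bb (algebraMap L (QuadraticAlgebra L δ 0) ∘ d) z z).re =
        bb d (fun i => (z i).re) (fun i => (z i).re) + δ * bb d (fun i => (z i).im) (fun i => (z i).im) := by
    intro z
    change QuadraticAlgebra.reₗ _ _ (bb (algebraMap L (QuadraticAlgebra L δ 0) ∘ d) z z) = _
    simp only [bb, map_sum, Finset.mul_sum]
    rw [← Finset.sum_add_distrib]
    refine Finset.sum_congr rfl fun i _ => ?_
    simp
    ring
  have him : ∀ z : Fin M → QuadraticAlgebra L δ 0,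
      (bb (algebraMap L (QuadraticAlgebra L δ 0) ∘ d) z z).im =
        2 * bb d (fun i => (z i).re) (fun i => (z i).im) := by
    intro z
    change QuadraticAlgebra.imₗ _ _ (bb (algebraMap L (QuadraticAlgebra L δ 0) ∘ d) z z) = _
    simp only [bb, map_sum, Finset.mul_sum]
    refine Finset.sum_congr rfl fun i _ => ?_
    simp
    ring
  let dup : (Fin h → QuadraticAlgebra L δ 0) →ₗ[L] (Fin h ⊕ Fin h → QuadraticAlgebra L δ 0) :=
    { toFun := fun v => Sum.elim v v
      map_add' := by intro v w; funext j; cases j <;> rfl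
      map_smul' := by intro c w; funext j; cases j <;> rfl }
  let z : (Fin h → QuadraticAlgebra L δ 0) →ₗ[L] (Fin M → QuadraticAlgebra L δ 0) :=
    (f.symm.toLinearMap.restrictScalars L) ∘ₗ dup
  have hz0 : ∀ v, bb (algebraMap L (QuadraticAlgebra L δ 0) ∘ d) (z v) (z v) = 0 := by
    intro v
    rw [← hf]
    have : f (z v) = Sum.elim v v := by
      change f (f.symm (Sum.elim v v)) = _
      simp
    rw [this, bb_sum_elim]
    simp [bb]
  let g : (Fin h → QuadraticAlgebra L δ 0) →ₗ[L] (Fin M → L) :=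
    { toFun := fun v i => (z v i).re
      map_add' := by intro v w; funext j; simp
      map_smul' := by intro c w; funext j; simp }
  have hg : ∀ v i, g v i = (z v i).re := fun _ _ => rfl
  have hinj : Function.Injective g := by
    rw [injective_iff_map_eq_zero]
    intro v hv
    have h0 := congrArg QuadraticAlgebra.re (hz0 v)
    rw [hre] at h0
    have hv' : (fun i => (z v i).re) = 0 := hv
    rw [hv'] at h0
    have h1 : bb d (fun i => (z v i).im) (fun i => (z v i).im) = 0 := by
      have : bb d 0 0 = 0 := by simp [bb]
      rw [this, zero_add] at h0
      exact (mul_eq_zero.1 h0).resolve_left hδ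
    have h3 := hd _ h1
    have h4 : z v = 0 := by
      funext i
      exact QuadraticAlgebra.ext (congrFun hv' i) (congrFun h3 i)
    have h5 : Sum.elim v v = 0 := by
      have : f (z v) = Sum.elim v v := by
        change f (f.symm (Sum.elim v v)) = _
        simp
      rw [← this, h4, map_zero]
    funext j
    exact congrFun h5 (Sum.inl j)
  have hsurj : Function.Surjective g := by
    refine (LinearMap.injective_iff_surjective_of_finrank_eq_finrank ?_).1 hinj
    rw [Module.finrank_pi_fintype]
    simp [QuadraticAlgebra.finrank_eq_two]
    omega
  obtain ⟨v, hv⟩ := hsurj (Pi.single i 1)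
  have hv' : (fun i => (z v i).re) = Pi.single i 1 := hv
  have h0 := congrArg QuadraticAlgebra.re (hz0 v)
  have h1 := congrArg QuadraticAlgebra.im (hz0 v)
  rw [hre, hv', bb_single] at h0
  rw [him, hv', bb_single] at h1
  simp at h0 h1
  refine ⟨δ • fun i => (z v i).im, ?_, ?_⟩
  · have := (h1.resolve_left h2).resolve_left (hd.ne_zero i)
    simp [this]
  · rw [bb_smul_left, bb_smul_right]
    linear_combination δ * h0

end P6

section P7

theorem two_map {F L : Type} [Field F] [Field L] (φ : F →+* L) (h2 : (2 : F) ≠ 0) : (2 : L) ≠ 0 := by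
  have := (map_ne_zero φ).2 h2
  rwa [map_ofNat] at this

def PS {F : Type} [Field F] {n t : ℕ} (c : Fin t → F) (a : Fin t → Fin n → F) : GW F :=
  ∑ s, gsc (c s) (RR (a s) Finset.univ)

theorem pp_map {F L : Type} [Field F] [Field L] (φ : F →+* L) {ι : Type} (a : ι → F) (T : Finset ι) :
    pp (φ ∘ a) T = φ (pp a T) := by
  simp [pp, map_prod]

theorem gmap_HH {F L : Type} [Field F] [Field L] (φ : F →+* L) (h2 : (2 : F) ≠ 0) :
    gmap φ h2 (HH F) = HH L := by
  simp [HH, gmap_gg]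

theorem gmap_PS {F L : Type} [Field F] [Field L] (φ : F →+* L) (h2 : (2 : F) ≠ 0) {n t : ℕ}
    (c : Fin t → F) (a : Fin t → Fin n → F) :
    gmap φ h2 (PS c a) = PS (φ ∘ c) (fun s => φ ∘ a s) := by
  simp only [PS, RR, map_sum, gsc_gg, gmap_gg, pp_map, map_mul, Function.comp]

theorem exists_tau (n : ℕ) : ∃ (N : ℕ) (_ : N + 1 = 2 ^ n) (τ : Fin (N + 1) ≃ Finset (Fin n)), τ 0 = ∅ := by
  obtain ⟨N, hN⟩ : ∃ N, 2 ^ n = N + 1 := ⟨2 ^ n - 1, by have := Nat.one_le_two_pow (n := n); omega⟩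
  have hc : Fintype.card (Fin (N + 1)) = Fintype.card (Finset (Fin n)) := by
    simp [hN]
  let τ0 := Fintype.equivOfCardEq hc
  exact ⟨N, hN.symm, (Equiv.swap 0 (τ0.symm ∅)).trans τ0, by simp⟩

theorem bb_tau {K : Type} [Field K] {n N : ℕ} (τ : Fin (N + 1) ≃ Finset (Fin n)) (a : Fin n → K)
    (x : Fin (N + 1) → K) : vv a Finset.univ (x ∘ τ.symm) = bb (pp a ∘ τ) x x := by
  unfold vv bb
  rw [Finset.powerset_univ, ← τ.sum_comp]
  simp

theorem haupt (n : ℕ) : ∀ (t : ℕ) (F : Type) [Field F] (_ : (2 : F) ≠ 0) (c : Fin t → F)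
    (a : Fin t → Fin n → F), (∀ s, c s ≠ 0) → (∀ s u, a s u ≠ 0) →
    ∀ (M : ℕ) (e : Fin M → F), (∀ i, e i ≠ 0) → M < 2 ^ n →
    ∀ A B : ℕ, cls e + A • HH F = PS c a + B • HH F → ∃ h : ℕ, cls e = h • HH F := by
  intro t
  induction t with
  | zero =>
    intro F _ h2 c a hc ha M e he hM A B h
    have hP : PS c a = 0 := by simp [PS]
    rw [hP, zero_add] at h
    have hd := congrArg gdim h
    rw [map_add, map_nsmul, map_nsmul, gdim_HH, gdim_cls] at hd
    simp at hd
    refine ⟨B - A, HH_cancel h2 A ?_⟩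
    rw [← add_smul, add_comm, h]
    congr 1; omega
  | succ t iht =>
    intro F _ h2 c a hc ha M
    induction M using Nat.strong_induction_on with
    | _ M ihM =>
      intro e he hM A B h
      by_cases hiso : Aniso e
      swap
      · obtain ⟨m, e', he', hm, hcl⟩ := split_iso h2 e he hiso
        rw [Fintype.card_fin] at hm
        obtain ⟨k, hk⟩ := ihM m (by omega) e' he' (by omega) (A + 1) B (by
          rw [← h, hcl, add_smul, one_smul]; abel)
        exact ⟨k + 1, by rw [hcl, hk, add_smul, one_smul, add_comm]⟩
      obtain _ | M := M
      · exact ⟨0, by simp [cls]⟩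
      -- the last Pfister form
      have hPS : PS c a = PS (fun s : Fin t => c s.succ) (fun s => a s.succ) +
          gsc (c 0) (RR (a 0) Finset.univ) := by
        unfold PS
        rw [Fin.sum_univ_succ, add_comm]
      obtain ⟨N, hN, τ, hτ⟩ := exists_tau n
      by_cases hπ : Aniso (pp (a 0) ∘ τ)
      swap
      · simp only [Aniso, not_forall] at hπ
        obtain ⟨x, hx, hx0⟩ := hπ
        obtain ⟨j, hj⟩ := Function.ne_iff.1 hx0
        obtain ⟨k, hk⟩ := (pfister (a 0) h2 (ha 0) Finset.univ).2 (x ∘ τ.symm) (by rw [bb_tau, hx])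
          ⟨τ j, by simp, by simpa using hj⟩
        rw [hPS, hk, gsc_nsmul_HH h2 _ (hc 0), add_assoc, ← add_smul] at h
        exact iht F h2 _ _ (fun s => hc _) (fun s u => ha _ _) _ e he hM A _ h
      exfalso
      obtain ⟨L, _, φ, x, hx, hA, hB⟩ := generic N F h2 (fun j => pp (a 0) (τ j.succ))
        (fun j => pp_ne _ (ha 0) _)
      have h2L := two_map φ h2
      set δ : L := - ∑ j, φ (pp (a 0) (τ j.succ)) * (x j * x j) with hδ
      have hN0 : 0 < N := by omega
      have hval : ∀ (E : Type) [Field E] (χ : L →+* E) (r : E),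
          bb ((χ.comp φ) ∘ (pp (a 0) ∘ τ)) (Fin.cons r (χ ∘ x)) (Fin.cons r (χ ∘ x)) = r * r - χ δ := by
        intro E _ χ r
        unfold bb
        rw [Fin.sum_univ_succ, hδ]
        simp only [Fin.cons_zero, Fin.cons_succ, Function.comp, hτ, map_neg, map_sum, map_mul,
          RingHom.comp_apply, sub_neg_eq_add]
        simp [pp]
      have hfact : Fact (∀ r : L, r ^ 2 ≠ δ + 0 * r) := ⟨by
        intro r hr
        have := hA _ _ hπ (Fin.cons r x) ((hval L (RingHom.id L) r).trans (by
          simp; linear_combination hr))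
        have := congrFun this (Fin.succ ⟨0, hN0⟩)
        rw [Fin.cons_succ] at this
        exact hx _ this⟩
      let E := QuadraticAlgebra L δ 0
      let χ : L →+* E := algebraMap L E
      have h' := congrArg (gmap (χ.comp φ) h2) h
      rw [hPS] at h'
      simp only [map_add, map_nsmul, gmap_HH, gmap_PS, gmap_cls] at h'
      have h2E : (2 : E) ≠ 0 := two_map χ h2L
      have hRR : gmap (χ.comp φ) h2 (gsc (c 0) (RR (a 0) Finset.univ)) =
          gsc (χ (φ (c 0))) (RR ((χ.comp φ) ∘ a 0) Finset.univ) := by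
        have := gmap_PS (χ.comp φ) h2 (fun _ : Fin 1 => c 0) (fun _ => a 0)
        simpa [PS] using this
      rw [hRR] at h'
      have hne : ∀ y : F, y ≠ 0 → (χ.comp φ) y ≠ 0 := fun y hy => (map_ne_zero _).2 hy
      obtain ⟨k, hk⟩ := (pfister ((χ.comp φ) ∘ a 0) h2E (fun u => hne _ (ha 0 u)) Finset.univ).2
        ((Fin.cons QuadraticAlgebra.omega (χ ∘ x) : Fin (N + 1) → E) ∘ τ.symm) (by
          rw [bb_tau]
          have e1 : pp ((χ.comp φ) ∘ a 0) ∘ τ = (χ.comp φ) ∘ (pp (a 0) ∘ τ) := by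
            funext j; exact pp_map _ _ _
          rw [e1, hval E χ, QuadraticAlgebra.omega_mul_omega_eq_mk]
          exact sub_self _) ⟨τ (Fin.succ ⟨0, hN0⟩), by simp, by
          simp only [Function.comp, Equiv.symm_apply_apply, Fin.cons_succ]
          exact (map_ne_zero χ).2 (hx _)⟩
      rw [hk, gsc_nsmul_HH h2E (χ (φ (c 0))) (hne _ (hc 0)), add_assoc, ← add_smul] at h'
      obtain ⟨k', hk'⟩ := iht E h2E _ _ (fun s => hne _ (hc _)) (fun s u => hne _ (ha _ _)) _ _
        (fun i => hne _ (he i)) hM A _ h'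
      obtain ⟨w, hw0, hw⟩ := quad h2L δ (φ ∘ e) (hA _ _ hiso) k' hk' 0
      have := hB M (fun j => (e 0)⁻¹ * e j.succ) (by
        intro y hy
        have h3 : bb e (Fin.cons 0 y) (Fin.cons 0 y) = 0 := by
          have : bb (fun j => (e 0)⁻¹ * e j.succ) y y = (e 0)⁻¹ * bb e (Fin.cons 0 y) (Fin.cons 0 y) := by
            unfold bb
            rw [Fin.sum_univ_succ]
            simp [Finset.mul_sum, mul_assoc]
          rw [this] at hy
          exact (mul_eq_zero.1 hy).resolve_left (inv_ne_zero (he 0))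
        have h4 := hiso _ h3
        funext j
        have := congrFun h4 j.succ
        rwa [Fin.cons_succ] at this) (fun j => w j.succ) (by
        have h5 : bb (φ ∘ e) w w = φ (e 0) * bb (φ ∘ fun j : Fin M => (e 0)⁻¹ * e j.succ)
            (fun j => w j.succ) (fun j => w j.succ) := by
          unfold bb
          rw [Fin.sum_univ_succ, hw0, Finset.mul_sum]
          simp only [mul_zero, zero_add]
          refine Finset.sum_congr rfl fun j _ => ?_
          have : φ (e 0) ≠ 0 := (map_ne_zero φ).2 (he 0)
          simp only [Function.comp, map_mul, map_inv₀]
          field_simp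
        rw [hw] at h5
        have h6 : φ (e 0) ≠ 0 := (map_ne_zero φ).2 (he 0)
        refine mul_left_cancel₀ h6 ?_
        rw [← h5, hδ, neg_neg, mul_comm]; rfl)
      omega
end P7

section P8

theorem cls_pfisterSum {k : Type} [Field k] {n t : ℕ} (c : Fin t → k) (a : Fin t → Fin n → k) :
    cls (fun p : Fin t × Finset (Fin n) => c p.1 * ∏ u ∈ p.2, a p.1 u) = PS c a := by
  unfold cls PS RR
  rw [Fintype.sum_prod_type]
  refine Finset.sum_congr rfl fun s _ => ?_
  rw [map_sum, Finset.powerset_univ]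
  refine Finset.sum_congr rfl fun T _ => ?_
  rw [gsc_gg]; rfl

theorem wittSet_bdd {k : Type} [Field k] {m : ℕ} (d : Fin m → k) :
    BddAbove {i : ℕ | ∃ (s : ℕ) (e : Fin s → k), FormIsom k d (Sum.elim (hypForm k i) e)} := by
  refine ⟨m, ?_⟩
  rintro i ⟨s, e, h⟩
  have := h.card_eq
  simp only [Fintype.card_fin, Fintype.card_sum] at this
  omega

theorem wittIndex_spec {k : Type} [Field k] {m : ℕ} (d : Fin m → k) :
    ∃ (s : ℕ) (e : Fin s → k), FormIsom k d (Sum.elim (hypForm k (wittIndex k d)) e) := by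
  have := Nat.sSup_mem (s := {i : ℕ | ∃ (s : ℕ) (e : Fin s → k), FormIsom k d (Sum.elim (hypForm k i) e)})
    ⟨0, m, d, by
      rw [← cls_eq_iff, cls_sum, cls_hypForm, zero_nsmul, zero_add]⟩ (wittSet_bdd d)
  exact this

theorem le_wittIndex {k : Type} [Field k] {m : ℕ} (d : Fin m → k) (i s : ℕ) (e : Fin s → k)
    (h : cls d = i • HH k + cls e) : i ≤ wittIndex k d := by
  refine le_csSup (wittSet_bdd d) ⟨s, e, ?_⟩
  rw [← cls_eq_iff, cls_sum, cls_hypForm, h]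

theorem hypForm_ne {k : Type} [Field k] (h : ℕ) (j) : hypForm k h j ≠ 0 := by
  unfold hypForm
  split_ifs <;> simp

theorem cls_append {k : Type} [Field k] {m r : ℕ} (d : Fin m → k) (σ : Fin r → k) :
    cls (Fin.append d σ) = cls d + cls σ := by
  unfold cls
  rw [Fin.sum_univ_add]
  simp

theorem append_ne {k : Type} [Field k] {m r : ℕ} (d : Fin m → k) (σ : Fin r → k)
    (hd : ∀ i, d i ≠ 0) (hσ : ∀ i, σ i ≠ 0) (j) : Fin.append d σ j ≠ 0 := by
  refine Fin.addCases (fun i => ?_) (fun i => ?_) j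
  · simpa using hd i
  · simpa using hσ i

end P8

/-- **Proposition (LGP for I^n-neighbors).**  Let `k` be a field of characteristic ≠ 2
equipped with a non-empty set `V` of non-trivial discrete valuations with respect to
which the local-global principle for isometry holds.  Let `q` be an `I^n`-neighborof
complementary dimension `r` over `k` for some `n ≥ 1`.  Then `q` satisfies
`LGP((dim q + r - 2^n)/2 + 1, (dim q - r)/2)` with respect to `V` (the parameters being
computed in `ℤ`). -/
theorem statement6 (k : Type) [Field k] (hchar : ringChar k ≠ 2)
    (V : Set (Valuation k Zm0)) (hV : V.Nonempty) (hVnt : ∀ v ∈ V, isNontrivialVal v)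
    (hisom : ∀ (n₁ n₂ : ℕ) (d₁ : Fin n₁ → k) (d₂ : Fin n₂ → k),
      (∀ t, d₁ t ≠ 0) → (∀ t, d₂ t ≠ 0) →
      (∀ v ∈ V, FormIsom (valCompletion v) (toValCompletion v ∘ d₁) (toValCompletion v ∘ d₂)) →
      FormIsom k d₁ d₂)
    (n : ℕ) (hn : 1 ≤ n) (m r : ℕ) (d : Fin m → k) (hreg : ∀ t, d t ≠ 0)
    (hnb : isIneighbor k n d r)
    (hloc : ∀ v ∈ V, ((m : ℤ) + r - 2 ^ n) / 2 + 1 ≤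
      (wittIndex (valCompletion v) (toValCompletion v ∘ d) : ℤ)) :
    ((m : ℤ) - r) / 2 ≤ (wittIndex k d : ℤ) := by
  have h2 : (2 : k) ≠ 0 := Ring.two_ne_zero hchar
  obtain ⟨hrm, σ, hσ, t, c, a, hc, ha, A, B, hw⟩ := hnb
  have hcard := hw.card_eq
  rw [← cls_eq_iff, cls_sum, cls_sum, cls_sum, cls_hypForm, cls_hypForm, cls_pfisterSum] at hw
  obtain ⟨n', rfl⟩ : ∃ n', n = n' + 1 := ⟨n - 1, by omega⟩
  have hpar : ∃ h, m + r = 2 * h := by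
    simp only [Fintype.card_sum, Fintype.card_fin, Fintype.card_prod, Fintype.card_finset] at hcard
    refine ⟨t * 2 ^ n' + B - A, ?_⟩
    have : t * 2 ^ (n' + 1) = 2 * (t * 2 ^ n') := by ring
    omega
  obtain ⟨h, hh⟩ := hpar
  have key : FormIsom k (Fin.append d σ) (hypForm k h) := by
    refine hisom _ _ _ _ (append_ne d σ hreg hσ) (hypForm_ne h) fun v hv => ?_
    set φ := toValCompletion v
    have h2v : (2 : valCompletion v) ≠ 0 := two_map φ h2
    have hne : ∀ y : k, y ≠ 0 → φ y ≠ 0 := fun y hy => (map_ne_zero φ).2 hy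
    rw [← cls_eq_iff, ← gmap_cls φ h2, ← gmap_cls φ h2, cls_append, cls_hypForm, map_nsmul, gmap_HH,
      map_add, gmap_cls, gmap_cls]
    have hl := hloc v hv
    obtain ⟨s, e, he⟩ := wittIndex_spec (φ ∘ d)
    set i := wittIndex (valCompletion v) (φ ∘ d) with hi
    have hs := he.card_eq
    simp only [Fintype.card_sum, Fintype.card_fin] at hs
    have hene : ∀ j, e j ≠ 0 := fun j => ne_zero_of_isom h2v he (fun t => hne _ (hreg t)) (Sum.inr j)
    rw [← cls_eq_iff, cls_sum, cls_hypForm] at he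
    have hw' := congrArg (gmap φ h2) hw
    simp only [map_add, map_nsmul, gmap_HH, gmap_cls, gmap_PS] at hw'
    obtain ⟨x, hx⟩ := haupt (n' + 1) t (valCompletion v) h2v _ _ (fun s => hne _ (hc s))
      (fun s u => hne _ (ha s u)) (s + r) (Fin.append e (φ ∘ σ))
      (append_ne _ _ hene (fun t => hne _ (hσ t))) (by
        have e1 : (2 : ℤ) ^ (n' + 1) = 2 * 2 ^ n' := by ring
        have e2 : (2 : ℕ) ^ (n' + 1) = 2 * 2 ^ n' := by ring
        have e3 : ((2 ^ n' : ℕ) : ℤ) = 2 ^ n' := by push_cast; rfl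
        rw [e1] at hl
        rw [e2]
        omega) (i + A) B (by
        refine Eq.trans ?_ hw'
        rw [cls_append, he, add_smul]
        abel)
    have hxd := congrArg gdim hx
    rw [gdim_cls, map_nsmul, gdim_HH] at hxd
    simp at hxd
    rw [he, add_assoc, ← cls_append, hx, ← add_smul]
    congr 1
    omega
  rw [← cls_eq_iff, cls_append, cls_hypForm] at key
  have hneg : cls σ + cls (fun j => - σ j) = r • HH k := by
    unfold cls
    rw [← Finset.sum_add_distrib]
    simp [gg_add_neg h2 _ (hσ _)]
  have hfin : cls d = (h - r) • HH k + cls (fun j => - σ j) := by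
    refine HH_cancel h2 r ?_
    rw [← add_assoc, ← add_smul, show r + (h - r) = h by omega, ← key, ← hneg]
    abel
  have := le_wittIndex d _ _ _ hfin
  omega
end

section
/- Let K be a complete discretely valued field with residue field k of characteristic ≠ 2 such that u(k) < ∞. If i is any integer with u(k) < i < u(K), then m_{i,1}(K) = min over ⌈i/2⌉ ≤ s ≤ u(k) of the quantities m_{s,1}(k) + m_{i−s+1,1}(k) and m_{i−u(k),1}(k). -/
/-- The u-invariant of a field: the supremum of the dimensions of anisotropic regular
quadratic forms over `k` (`⊤` if unbounded). -/
noncomputable def uInv (k : Type) [Field k] : ℕ∞ :=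
  sSup {N : ℕ∞ | ∃ n : ℕ, N = n ∧
    ∃ d : Fin n → k, (∀ t, d t ≠ 0) ∧ (diagQF k d).Anisotropic}

/-- The refined m-invariant `m_{i,j}(k)`: the least dimension (`⊤` if there is none) of a
regular quadratic form `q` of dimension ≥ 1 over `k` with `i_W(q) < j` such that
`i_W(q ⟂ σ) ≥ j` for every `i`-dimensional regular form `σ` over `k`. -/
noncomputable def mInv (k : Type) [Field k] (i j : ℕ) : ℕ∞ :=
  sInf {N : ℕ∞ | ∃ n : ℕ, N = n ∧ 1 ≤ n ∧
    ∃ d : Fin n → k, (∀ t, d t ≠ 0) ∧ wittIndex k d < j ∧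
      ∀ σ : Fin i → k, (∀ t, σ t ≠ 0) → j ≤ wittIndex k (Sum.elim d σ)}
/-- The residue field of (the valuation ring of) a discrete valuation on a field. -/
noncomputable abbrev resField (K : Type) [Field K] (v : Valuation K Zm0) : Type :=
  IsLocalRing.ResidueField ↥v.valuationSubring


namespace S19

section Val
variable {K : Type} [Field K] (v : Valuation K Zm0)

lemma exists_unif (hdisc : Function.Surjective v) : ∃ p : K, v p = WithZero.exp (-1 : ℤ) :=
  hdisc _

lemma mem_max_pow {p : K} (hp : v p = WithZero.exp (-1 : ℤ)) (n : ℕ) (x : v.valuationSubring) :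
    x ∈ (IsLocalRing.maximalIdeal v.valuationSubring) ^ n ↔ v (x : K) ≤ v p ^ n := by
  have hp0 : p ≠ 0 := by
    rintro rfl
    rw [map_zero] at hp
    exact WithZero.exp_ne_zero hp.symm
  have hvp : v p ≠ 0 := by simpa using hp0
  have hp1 : v p < 1 := by
    rw [hp, ← WithZero.exp_zero, WithZero.exp_lt_exp]; norm_num
  let P : v.valuationSubring := ⟨p, hp1.le⟩
  have hI : IsLocalRing.maximalIdeal v.valuationSubring = Ideal.span {P} := by
    ext y
    rw [Valuation.mem_maximalIdeal_iff, Ideal.mem_span_singleton]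
    constructor
    · intro hy
      have hy' : v (y : K) ≤ v p := by
        by_cases h0 : v (y : K) = 0
        · rw [h0]; exact zero_le
        · rw [hp]
          have e := WithZero.exp_log h0
          rw [← e] at hy ⊢
          rw [← WithZero.exp_zero, WithZero.exp_lt_exp] at hy
          rw [WithZero.exp_le_exp]; omega
      refine ⟨⟨(y : K) / p, ?_⟩, ?_⟩
      · rw [Valuation.mem_valuationSubring_iff, map_div₀]
        exact div_le_one_of_le₀ hy' zero_le
      · ext
        change (y : K) = p * (y / p)
        field_simp
    · rintro ⟨c, rfl⟩
      change v (p * c) < 1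
      rw [map_mul]
      calc v p * v c ≤ v p * 1 := by gcongr; exact c.2
        _ < 1 := by simpa using hp1
  rw [hI, Ideal.span_singleton_pow, Ideal.mem_span_singleton]
  constructor
  · rintro ⟨c, rfl⟩
    change v (p ^ n * c) ≤ _
    rw [map_mul, map_pow]
    calc v p ^ n * v c ≤ v p ^ n * 1 := by gcongr; exact c.2
      _ = _ := by simp
  · intro hx
    refine ⟨⟨(x : K) / p ^ n, ?_⟩, ?_⟩
    · rw [Valuation.mem_valuationSubring_iff, map_div₀, map_pow]
      exact div_le_one_of_le₀ hx zero_le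
    · ext
      change (x : K) = p ^ n * (x / p ^ n)
      field_simp

lemma complete_aux (p : K) (hp : v p = WithZero.exp (-1 : ℤ))
    (hcomp : @CompleteSpace K (Valued.mk' v).toUniformSpace) (f : ℕ → K)
    (hf : ∀ m n, m ≤ n → v (f n - f m) ≤ v p ^ m) :
    ∃ L : K, ∀ n, v (f n - L) ≤ v p ^ n := by
  let _ : Valued K Zm0 := Valued.mk' v
  have hp0 : p ≠ 0 := by
    rintro rfl
    rw [map_zero] at hp
    exact WithZero.exp_ne_zero hp.symm
  have hp1 : v p < 1 := by
    rw [hp, ← WithZero.exp_zero, WithZero.exp_lt_exp]; norm_num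
  have hc : CauchySeq f := by
    rw [(Valued.hasBasis_uniformity K Zm0).cauchySeq_iff']
    intro γ _
    obtain ⟨n, hn⟩ := exists_pow_lt₀ hp1
      (Units.map (MonoidWithZeroHom.ValueGroup₀.embedding (f := (.ofClass v))) γ)
    refine ⟨n, fun m hm => ?_⟩
    change v.restrict (f n - f m) < γ.1
    rw [Valuation.restrict_lt_iff_lt_embedding]
    rw [Valuation.map_sub_swap]
    exact (hf _ _ hm).trans_lt hn
  obtain ⟨L, hL⟩ := cauchySeq_tendsto_of_complete hc
  refine ⟨L, fun n => ?_⟩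
  have hne : v.restrict (p ^ n) ≠ 0 := by simp [hp0]
  have hmem : {y : K | v.restrict (y - L) < v.restrict (p ^ n)} ∈ nhds L := by
    rw [Valued.mem_nhds]
    exact ⟨Units.mk0 _ hne, fun y hy => hy⟩
  have h1 := (hL.eventually hmem).and (Filter.eventually_ge_atTop n)
  obtain ⟨m, hm, hmn⟩ := h1.exists
  have hm' : v (f m - L) < v (p ^ n) := (Valuation.restrict_lt_iff v).mp hm
  rw [map_pow] at hm'
  have : f n - L = (f m - L) - (f m - f n) := by ring
  rw [this]
  exact (Valuation.map_sub v _ _).trans (max_le hm'.le (hf _ _ hmn))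

lemma adic (hdisc : Function.Surjective v)
    (hcomp : @CompleteSpace K (Valued.mk' v).toUniformSpace) :
    IsAdicComplete (IsLocalRing.maximalIdeal v.valuationSubring) v.valuationSubring := by
  obtain ⟨p, hp⟩ := exists_unif v hdisc
  have hp1 : v p < 1 := by
    rw [hp, ← WithZero.exp_zero, WithZero.exp_lt_exp]; norm_num
  have key := mem_max_pow v hp
  refine { haus' := ?_, prec' := ?_ }
  · intro x hx
    by_contra h0
    have hv : v (x : K) ≠ 0 := by simpa using h0
    obtain ⟨n, hn⟩ := exists_pow_lt₀ hp1 (Units.mk0 _ hv)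
    have := hx n
    rw [SModEq.zero, smul_eq_mul, Ideal.mul_top, key] at this
    exact absurd this (not_le.mpr hn)
  · intro f hf
    have hf' : ∀ m n, m ≤ n → v ((f n : K) - f m) ≤ v p ^ m := by
      intro m n hmn
      have := (hf hmn).symm
      rw [SModEq.sub_mem, smul_eq_mul, Ideal.mul_top, key] at this
      exact this
    obtain ⟨L, hL⟩ := complete_aux v p hp hcomp (fun n => (f n : K)) hf'
    have hL1 : v L ≤ 1 := by
      have h := hL 0
      have : L = (f 0 : K) - ((f 0 : K) - L) := by ring
      rw [this]
      exact (Valuation.map_sub v _ _).trans (max_le (f 0).2 (by simpa using h))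
    refine ⟨⟨L, hL1⟩, fun n => ?_⟩
    rw [SModEq.sub_mem, smul_eq_mul, Ideal.mul_top, key]
    exact hL n

lemma two_ne (hchar : ringChar (resField K v) ≠ 2) : (2 : resField K v) ≠ 0 :=
  Ring.two_ne_zero hchar

lemma hensel_sq (hdisc : Function.Surjective v)
    (hcomp : @CompleteSpace K (Valued.mk' v).toUniformSpace)
    (hchar : ringChar (resField K v) ≠ 2) (a : v.valuationSubring) (y : resField K v) (hy : y ≠ 0)
    (hay : IsLocalRing.residue _ a = y ^ 2) :
    ∃ Y : v.valuationSubring, Y ^ 2 = a ∧ IsLocalRing.residue _ Y = y := by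
  have := adic v hdisc hcomp
  obtain ⟨Y0, rfl⟩ := IsLocalRing.residue_surjective y
  have := HenselianRing.is_henselian (I := IsLocalRing.maximalIdeal v.valuationSubring)
    (Polynomial.X ^ 2 - Polynomial.C a) (Polynomial.monic_X_pow_sub_C a two_ne_zero) Y0 ?_ ?_
  · obtain ⟨Y, h1, h2⟩ := this
    refine ⟨Y, ?_, ?_⟩
    · simpa [Polynomial.IsRoot, sub_eq_zero] using h1
    · rw [← sub_eq_zero, ← map_sub]
      exact (IsLocalRing.residue_eq_zero_iff _).2 h2
  · rw [← IsLocalRing.residue_eq_zero_iff]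
    simp [hay]
  · have : IsUnit (IsLocalRing.residue v.valuationSubring (2 * Y0)) := by
      rw [isUnit_iff_ne_zero, map_mul]
      exact mul_ne_zero (by rw [map_ofNat]; exact two_ne v hchar) hy
    have h2 : Polynomial.eval Y0 (Polynomial.derivative (Polynomial.X ^ 2 - Polynomial.C a)) =
        2 * Y0 := by simp [one_add_one_eq_two]
    rw [h2]
    exact this

end Val

section Springer

/-- elementary anisotropy -/
def An {k : Type} [Field k] {ι : Type} [Fintype ι] (d : ι → k) : Prop :=
  ∀ x : ι → k, ∑ t, d t * x t ^ 2 = 0 → x = 0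

lemma An.ne {k : Type} [Field k] {ι : Type} [Fintype ι] {d : ι → k} (h : An d) (t : ι) :
    d t ≠ 0 := by
  classical
  intro h0
  have := h (Pi.single t 1) (by
    apply Finset.sum_eq_zero
    intro s _
    by_cases hs : s = t
    · subst hs; simp [h0]
    · simp [hs])
  simpa using congrFun this t

lemma An.comp {k : Type} [Field k] {ι κ : Type} [Fintype ι] [Fintype κ] {d : ι → k} (h : An d)
    (f : κ → ι) (hf : Function.Injective f) : An (d ∘ f) := by
  classical
  intro x hx
  have h1 := h (Function.extend f x 0) (by
    rw [← hx]
    symm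
    apply Finset.sum_of_injOn f (hf.injOn) (by simp)
    · intro i _ hi
      rw [Function.extend_apply']
      · simp
      · rintro ⟨a, rfl⟩; exact hi (by simp)
    · intro i _
      simp [hf.extend_apply])
  ext t
  have := congrFun h1 (f t)
  simpa [hf.extend_apply] using this

variable {K : Type} [Field K] (v : Valuation K Zm0)

/-- `a = c² p^e w` with `w` a unit of residue `r`. -/
def Rep (p : K) (a : K) (e : Bool) (r : resField K v) : Prop :=
  ∃ c : K, c ≠ 0 ∧ ∃ w : v.valuationSubring, IsLocalRing.residue _ w = r ∧
    a = c ^ 2 * (if e then p else 1) * w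

lemma v_eq_one_of_residue {w : v.valuationSubring} (h : IsLocalRing.residue _ w ≠ 0) :
    v (w : K) = 1 := by
  rw [Ne, IsLocalRing.residue_eq_zero_iff, Valuation.mem_maximalIdeal_iff, not_lt] at h
  exact le_antisymm w.2 h

lemma residue_ne_zero {w : v.valuationSubring} (h : v (w : K) = 1) :
    IsLocalRing.residue _ w ≠ 0 := by
  rw [Ne, IsLocalRing.residue_eq_zero_iff, Valuation.mem_maximalIdeal_iff, h]
  exact lt_irrefl _

lemma exists_rep {p : K} (hp : v p = WithZero.exp (-1 : ℤ)) (a : K) (ha : a ≠ 0) :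
    ∃ e r, r ≠ 0 ∧ Rep v p a e r := by
  have hp0 : p ≠ 0 := by
    rintro rfl
    rw [map_zero] at hp
    exact WithZero.exp_ne_zero hp.symm
  have hva : v a ≠ 0 := by simpa using ha
  have e := WithZero.exp_log hva
  set n := WithZero.log (v a) with hn
  obtain ⟨m, hm⟩ : ∃ m : ℤ, n = 2 * (-m) ∨ n = 2 * (-m) - 1 := ⟨-((n + 1) / 2), by omega⟩
  have hzp : v (p ^ m) = WithZero.exp (-m) := by
    rw [map_zpow₀, hp, ← WithZero.exp_zsmul]; simp
  rcases hm with hm | hm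
  · have h1 : v (a / (p ^ m) ^ 2) = 1 := by
      rw [map_div₀, map_pow, hzp, ← e, hm, ← WithZero.exp_nsmul]
      simp
    refine ⟨false, IsLocalRing.residue _ ⟨a / (p ^ m) ^ 2, h1.le⟩, residue_ne_zero v h1,
      p ^ m, zpow_ne_zero _ hp0, _, rfl, ?_⟩
    simp
    field_simp
  · have h1 : v (a / ((p ^ m) ^ 2 * p)) = 1 := by
      rw [map_div₀, map_mul, map_pow, hzp, hp, ← e, hm, ← WithZero.exp_nsmul, ← WithZero.exp_add]
      simp [sub_eq_add_neg]
    refine ⟨true, IsLocalRing.residue _ ⟨a / ((p ^ m) ^ 2 * p), h1.le⟩, residue_ne_zero v h1,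
      p ^ m, zpow_ne_zero _ hp0, _, rfl, ?_⟩
    simp
    field_simp

lemma exists_lift {p : K} (e : Bool) (r : resField K v) : ∃ a, Rep v p a e r := by
  obtain ⟨w, rfl⟩ := IsLocalRing.residue_surjective r
  exact ⟨_, 1, one_ne_zero, w, rfl, rfl⟩

/-- valuation of unit forms with anisotropic residue -/
lemma unit_form_val {ι : Type} [Fintype ι] (w : ι → v.valuationSubring)
    (h : An (fun t => IsLocalRing.residue _ (w t))) (y : ι → K) (hy : y ≠ 0) :
    ∃ z : K, z ≠ 0 ∧ v (∑ t, (w t : K) * y t ^ 2) = v z ^ 2 := by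
  classical
  obtain ⟨t0, ht0⟩ := Function.ne_iff.mp hy
  obtain ⟨t, -, ht⟩ := Finset.exists_max_image Finset.univ (fun t => v (y t)) ⟨t0, by simp⟩
  have hyt : y t ≠ 0 := by
    intro h0
    have := ht t0 (by simp)
    rw [h0, map_zero] at this
    exact ht0 (by simpa using le_antisymm this zero_le)
  have hvt : v (y t) ≠ 0 := by simpa using hyt
  let Y : ι → v.valuationSubring := fun s => ⟨y s / y t, by
    rw [Valuation.mem_valuationSubring_iff, map_div₀]
    exact div_le_one_of_le₀ (ht s (by simp)) zero_le⟩
  have h1 : v (((∑ s, w s * Y s ^ 2 : v.valuationSubring)) : K) = 1 := by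
    apply v_eq_one_of_residue
    intro h0
    rw [map_sum] at h0
    simp only [map_mul, map_pow] at h0
    have h2 := congrFun (h (fun s => IsLocalRing.residue _ (Y s)) h0) t
    refine residue_ne_zero v (w := Y t) ?_ h2
    change v (y t / y t) = 1
    rw [div_self hyt, map_one]
  refine ⟨y t, hyt, ?_⟩
  have h3 : ∑ s, (w s : K) * y s ^ 2 =
      y t ^ 2 * ((∑ s, w s * Y s ^ 2 : v.valuationSubring) : K) := by
    push_cast
    rw [Finset.mul_sum]
    refine Finset.sum_congr rfl fun s _ => ?_
    change _ = y t ^ 2 * ((w s : K) * (y s / y t) ^ 2)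
    field_simp
  rw [h3, map_mul, h1, map_pow, mul_one]

lemma sum_split {ι : Type} [Fintype ι] (e : ι → Bool) (f : ι → K) :
    ∑ t, f t = ∑ t : {t // e t = false}, f t + ∑ t : {t // e t = true}, f t := by
  classical
  rw [← Fintype.sum_subtype_add_sum_subtype (fun t => e t = false) f]
  congr 1
  refine Fintype.sum_equiv (Equiv.subtypeEquivRight (by simp)) _ _ (by intro x; rfl)

lemma springer_aniso {p : K} (hp : v p = WithZero.exp (-1 : ℤ)) {ι : Type} [Fintype ι]
    (σ : ι → K) (e : ι → Bool) (r : ι → resField K v) (hr : ∀ t, Rep v p (σ t) (e t) (r t))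
    (h : ∀ b, An (fun t : {t // e t = b} => r t)) : An σ := by
  choose c hc w hw hσ using hr
  intro x hx
  rw [sum_split e] at hx
  have h0 : ∑ t : {t // e t = false}, σ t * x t ^ 2 =
      ∑ t : {t // e t = false}, (w t : K) * (c t * x t) ^ 2 := by
    refine Finset.sum_congr rfl fun t _ => ?_
    rw [hσ, t.2]
    simp only [Bool.false_eq_true, if_false]
    ring
  have h1 : ∑ t : {t // e t = true}, σ t * x t ^ 2 =
      p * ∑ t : {t // e t = true}, (w t : K) * (c t * x t) ^ 2 := by
    rw [Finset.mul_sum]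
    refine Finset.sum_congr rfl fun t _ => ?_
    rw [hσ, t.2]
    simp only [if_true]
    ring
  rw [h0, h1] at hx
  have hA : ∀ b, (fun t : {t // e t = b} => c t * x t) ≠ 0 →
      ∃ z : K, z ≠ 0 ∧ v (∑ t : {t // e t = b}, (w t : K) * (c t * x t) ^ 2) = v z ^ 2 := by
    intro b hb
    refine unit_form_val v (fun t : {t // e t = b} => w t) ?_ _ hb
    simpa only [hw] using h b
  have hfin : ∀ b, (fun t : {t // e t = b} => c t * x t) = 0 := by
    by_cases hf : (fun t : {t // e t = false} => c t * x t) = 0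
    · by_cases ht : (fun t : {t // e t = true} => c t * x t) = 0
      · rintro (_ | _) <;> assumption
      · exfalso
        obtain ⟨z, hz, hz2⟩ := hA _ ht
        have : ∑ t : {t // e t = false}, (w t : K) * (c t * x t) ^ 2 = 0 :=
          Finset.sum_eq_zero fun t _ => by
            have := congrFun hf t
            simp only [Pi.zero_apply] at this
            rw [this]; simp
        rw [this, zero_add] at hx
        have := congrArg v hx
        rw [map_mul, hz2, hp] at this
        simp [hz] at this
    · exfalso
      obtain ⟨z, hz, hz2⟩ := hA _ hf
      have hx' := congrArg v (eq_neg_of_add_eq_zero_left hx)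
      rw [Valuation.map_neg, map_mul, hz2, hp] at hx'
      by_cases ht : (fun t : {t // e t = true} => c t * x t) = 0
      · have : ∑ t : {t // e t = true}, (w t : K) * (c t * x t) ^ 2 = 0 :=
          Finset.sum_eq_zero fun t _ => by
            have := congrFun ht t
            simp only [Pi.zero_apply] at this
            rw [this]; simp
        rw [this] at hx'
        simp [hz] at hx'
      · obtain ⟨y, hy, hy2⟩ := hA _ ht
        rw [hy2] at hx'
        have e1 := WithZero.exp_log (show v z ≠ 0 by simpa using hz)
        have e2 := WithZero.exp_log (show v y ≠ 0 by simpa using hy)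
        rw [← e1, ← e2, ← WithZero.exp_nsmul, ← WithZero.exp_nsmul, ← WithZero.exp_add,
          WithZero.exp_inj] at hx'
        simp only [nsmul_eq_mul, Nat.cast_ofNat] at hx'
        omega
  ext t
  have := congrFun (hfin (e t)) ⟨t, rfl⟩
  simpa [hc t] using this

lemma springer_iso (hdisc : Function.Surjective v)
    (hcomp : @CompleteSpace K (Valued.mk' v).toUniformSpace)
    (hchar : ringChar (resField K v) ≠ 2) {p : K} {ι : Type} [Fintype ι]
    (σ : ι → K) (e : ι → Bool) (r : ι → resField K v) (hr : ∀ t, Rep v p (σ t) (e t) (r t))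
    (hr0 : ∀ t, r t ≠ 0)
    (h : An σ) (b : Bool) : An (fun t : {t // e t = b} => r t) := by
  classical
  choose c hc w hw hσ using hr
  intro x hx
  by_contra hx0
  obtain ⟨j, hj⟩ := Function.ne_iff.mp hx0
  simp only [Pi.zero_apply] at hj
  choose X hX using fun t => IsLocalRing.residue_surjective (R := v.valuationSubring) (x t)
  obtain ⟨W, hW⟩ : ∃ W, w j * W = 1 := by
    have : IsUnit (w j.1) := by
      by_contra hu
      exact hr0 j.1 ((hw j.1).symm.trans ((IsLocalRing.residue_eq_zero_iff _).2 hu))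
    exact this.exists_right_inv
  have hrW : r j * IsLocalRing.residue _ W = 1 := by
    rw [← hw, ← map_mul, hW, map_one]
  rw [Fintype.sum_eq_add_sum_subtype_ne _ j] at hx
  obtain ⟨Y, hY, hYr⟩ := hensel_sq v hdisc hcomp hchar
    (-(W * ∑ t : {t // t ≠ j}, w t.1 * X t.1 ^ 2)) (x j) hj (by
      simp only [map_neg, map_mul, map_sum, map_pow, hw, hX]
      rw [eq_neg_of_add_eq_zero_right hx]
      linear_combination (x j ^ 2) * hrW)
  let Z : {t // e t = b} → v.valuationSubring := Function.update X j Y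
  have hZ : ∑ t, w t.1 * Z t ^ 2 = 0 := by
    rw [Fintype.sum_eq_add_sum_subtype_ne _ j]
    have : ∑ t : {t // t ≠ j}, w t.1 * Z t.1 ^ 2 = ∑ t : {t // t ≠ j}, w t.1 * X t.1 ^ 2 := by
      refine Finset.sum_congr rfl fun t _ => ?_
      simp [Z, Function.update_of_ne t.2]
    rw [this]
    simp only [Z, Function.update_self, hY]
    linear_combination (-∑ t : {t // t ≠ j}, w t.1 * X t.1 ^ 2) * hW
  have hZK : ∑ t : {t // e t = b}, (w t.1 : K) * (Z t : K) ^ 2 = 0 := by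
    exact_mod_cast congrArg (fun a : v.valuationSubring => (a : K)) hZ
  have hsub : An (fun t : {t // e t = b} => σ t) := h.comp Subtype.val Subtype.val_injective
  have h3 := hsub (fun t => (Z t : K) / c t) (by
    rw [← mul_zero (if b then p else 1), ← hZK, Finset.mul_sum]
    refine Finset.sum_congr rfl fun t _ => ?_
    beta_reduce
    rw [hσ, t.2]
    have := hc t.1
    field_simp)
  have h4 := congrFun h3 j
  simp only [Z, Function.update_self, Pi.zero_apply, div_eq_zero_iff, hc, or_false] at h4
  have : Y = 0 := by exact_mod_cast h4
  rw [this, map_zero] at hYr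
  exact hj hYr.symm

end Springer

section CapSec

/-- `d` has an anisotropic extension by an `a`-dimensional form. -/
def Cap {k : Type} [Field k] {ι : Type} [Fintype ι] (d : ι → k) (a : ℕ) : Prop :=
  ∃ (κ : Type) (_ : Fintype κ) (σ : κ → k), Fintype.card κ = a ∧ An (Sum.elim d σ)

section
variable {k : Type} [Field k] {ι κ : Type} [Fintype ι] [Fintype κ]

lemma Cap.fin {d : ι → k} {a : ℕ} (h : Cap d a) :
    ∃ σ : Fin a → k, An (Sum.elim d σ) := by
  obtain ⟨κ, _, σ, hc, hA⟩ := h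
  let f := (Fintype.equivFinOfCardEq hc).symm
  refine ⟨σ ∘ f, ?_⟩
  have := hA.comp (Sum.map id f) (Function.Injective.sumMap Function.injective_id f.injective)
  convert this using 1
  ext (t | t) <;> rfl

lemma Cap.anti {d : ι → k} {a b : ℕ} (h : Cap d a) (hb : b ≤ a) : Cap d b := by
  obtain ⟨σ, hA⟩ := h.fin
  refine ⟨Fin b, inferInstance, σ ∘ Fin.castLE hb, by simp, ?_⟩
  have := hA.comp (Sum.map id (Fin.castLE hb))
    (Function.Injective.sumMap Function.injective_id (Fin.castLE_injective hb))
  convert this using 1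
  ext (t | t) <;> rfl

lemma Cap.comp {d : ι → k} {a : ℕ} (h : Cap d a) (f : κ → ι) (hf : Function.Injective f) :
    Cap (d ∘ f) a := by
  obtain ⟨τ, _, σ, hc, hA⟩ := h
  refine ⟨τ, inferInstance, σ, hc, ?_⟩
  have := hA.comp (Sum.map f id) (Function.Injective.sumMap hf Function.injective_id)
  convert this using 1
  ext (t | t) <;> rfl

lemma Cap.an {d : ι → k} {a : ℕ} (h : Cap d a) : An d := by
  obtain ⟨τ, _, σ, hc, hA⟩ := h
  exact hA.comp Sum.inl Sum.inl_injective

lemma An.cap {d : ι → k} (h : An d) : Cap d 0 := by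
  refine ⟨Fin 0, inferInstance, Fin.elim0, by simp, ?_⟩
  have := h.comp (Sum.elim id Fin.elim0 : ι ⊕ Fin 0 → ι) (by
    rintro (a | a) (b | b) h
    · simpa using h
    · exact b.elim0
    · exact a.elim0
    · exact a.elim0)
  convert this using 1
  ext (t | t)
  · rfl
  · exact t.elim0

lemma an_iff (d : ι → k) : An d ↔ (diagQF k d).Anisotropic := by
  unfold An QuadraticMap.Anisotropic diagQF
  simp only [QuadraticMap.weightedSumSquares_apply, smul_eq_mul, sq]

lemma An.card_le {u : ℕ} (hu : uInv k = (u : ℕ∞)) {d : ι → k} (h : An d) :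
    Fintype.card ι ≤ u := by
  have h1 : ((Fintype.card ι : ℕ) : ℕ∞) ≤ uInv k := by
    apply le_sSup
    let f := (Fintype.equivFin ι).symm
    have h2 := h.comp f f.injective
    exact ⟨_, rfl, d ∘ f, fun t => h2.ne t, (an_iff _).1 h2⟩
  rw [hu] at h1
  exact_mod_cast h1

lemma Cap.card_le {u : ℕ} (hu : uInv k = (u : ℕ∞)) {d : ι → k} {a : ℕ} (h : Cap d a) :
    Fintype.card ι + a ≤ u := by
  obtain ⟨τ, _, σ, hc, hA⟩ := h
  have := hA.card_le hu
  rw [Fintype.card_sum, hc] at this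
  exact this

lemma exists_max {u : ℕ} (hu : uInv k = (u : ℕ∞)) : ∃ d : Fin u → k, An d := by
  by_contra hno
  have h1 : uInv k ≤ ((u - 1 : ℕ) : ℕ∞) := by
    apply sSup_le
    rintro N ⟨n, rfl, d, hd, hA⟩
    rw [← an_iff] at hA
    have h2 := hA.card_le hu
    rw [Fintype.card_fin] at h2
    have h3 : n ≠ u := by rintro rfl; exact hno ⟨d, hA⟩
    exact_mod_cast (by omega : n ≤ u - 1)
  rw [hu] at h1
  have h4 : u ≤ u - 1 := by exact_mod_cast h1
  have h5 : u = 0 := by omega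
  subst h5
  exact hno ⟨Fin.elim0, fun x _ => Subsingleton.elim _ _⟩

lemma cap_empty {u : ℕ} (hu : uInv k = (u : ℕ∞)) (d : ι → k) [IsEmpty ι] : Cap d u := by
  obtain ⟨s, hs⟩ := exists_max hu
  refine ⟨Fin u, inferInstance, s, by simp, ?_⟩
  have := hs.comp (Sum.elim isEmptyElim id : ι ⊕ Fin u → Fin u) (by
    rintro (a | a) (b | b) h
    · exact isEmptyElim a
    · exact isEmptyElim a
    · exact isEmptyElim b
    · simpa using h)
  convert this using 1
  ext (t | t)
  · exact isEmptyElim t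
  · rfl

end

variable {K : Type} [Field K] (v : Valuation K Zm0)

lemma cap_core (hdisc : Function.Surjective v)
    (hcomp : @CompleteSpace K (Valued.mk' v).toUniformSpace)
    (hchar : ringChar (resField K v) ≠ 2) {p : K} (hp : v p = WithZero.exp (-1 : ℤ))
    {ι : Type} [Fintype ι]
    (q : ι → K) (e : ι → Bool) (r : ι → resField K v) (hr : ∀ t, Rep v p (q t) (e t) (r t))
    (hr0 : ∀ t, r t ≠ 0) (n : ℕ) :
    Cap q n ↔ ∃ a : Bool → ℕ, a false + a true = n ∧
      ∀ b, Cap (fun t : {t // e t = b} => r t) (a b) := by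
  classical
  constructor
  · rintro ⟨κ, _, σ, hc, hA⟩
    have hσ : ∀ t, σ t ≠ 0 := fun t => hA.ne (Sum.inr t)
    choose e' r' hr' hrep using fun t => exists_rep v hp (σ t) (hσ t)
    have hS := springer_iso v hdisc hcomp hchar (Sum.elim q σ) (Sum.elim e e') (Sum.elim r r')
      (by rintro (t | t); exacts [hr t, hrep t]) (by rintro (t | t); exacts [hr0 t, hr' t]) hA
    refine ⟨fun b => Fintype.card {t // e' t = b}, ?_, fun b => ⟨_, inferInstance, 
      fun t : {t // e' t = b} => r' t, rfl, ?_⟩⟩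
    · rw [← hc]
      have := sum_split (K := ℚ) e' (fun _ => 1)
      simp only [Finset.sum_const, Finset.card_univ, nsmul_eq_mul, mul_one] at this
      exact_mod_cast this.symm
    · let f : {t // e t = b} ⊕ {t // e' t = b} → {t : ι ⊕ κ // Sum.elim e e' t = b} :=
        Sum.elim (fun t => ⟨Sum.inl t.1, t.2⟩) (fun t => ⟨Sum.inr t.1, t.2⟩)
      have := (hS b).comp f (by
        rintro (⟨a, ha⟩ | ⟨a, ha⟩) (⟨b, hb⟩ | ⟨b, hb⟩) h <;>
          have h' := congrArg Subtype.val h <;> simpa [f] using h')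
      convert this using 1
      ext (t | t) <;> rfl
  · rintro ⟨a, hn, h⟩
    choose κ fκ σ hc hA using h
    choose s hs using fun t : (Σ b, κ b) => exists_lift v (p := p) t.1 (σ t.1 t.2)
    refine ⟨Σ b, κ b, inferInstance, s, ?_, ?_⟩
    · rw [Fintype.card_sigma]
      simp [hc, ← hn, add_comm]
    · refine springer_aniso v hp (Sum.elim q s) (Sum.elim e Sigma.fst)
        (Sum.elim r (fun t => σ t.1 t.2)) ?_ ?_
      · rintro (t | t)
        exacts [hr t, hs t]
      · intro b
        let f : {t : ι ⊕ (Σ b, κ b) // Sum.elim e Sigma.fst t = b} → {t // e t = b} ⊕ κ b :=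
          fun t => match t with
            | ⟨Sum.inl t, h⟩ => Sum.inl ⟨t, h⟩
            | ⟨Sum.inr ⟨b', t⟩, h⟩ => Sum.inr ((show b' = b from h) ▸ t)
        have := (hA b).comp f (by
          rintro ⟨a | ⟨b1, a⟩, ha⟩ ⟨c | ⟨b2, c⟩, hc⟩ h
          · have h' : (⟨a, ha⟩ : {t // e t = b}) = ⟨c, hc⟩ := Sum.inl.inj h
            have h2 : a = c := congrArg Subtype.val h'
            subst h2
            rfl
          · simp [f] at h
          · simp [f] at h
          · simp only [Sum.elim_inr] at ha hc
            subst ha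
            subst hc
            have h' : a = c := by simpa [f] using h
            rw [h'])
        convert this using 1
        ext ⟨t | ⟨b', t⟩, ht⟩
        · rfl
        · simp only [Sum.elim_inr] at ht
          subst ht
          rfl

/-- Decomposing a form over `K`. -/
lemma cap_decomp (hdisc : Function.Surjective v)
    (hcomp : @CompleteSpace K (Valued.mk' v).toUniformSpace)
    (hchar : ringChar (resField K v) ≠ 2)
    {ι : Type} [Fintype ι] (q : ι → K) (hq : ∀ t, q t ≠ 0) :
    ∃ (κ : Bool → Type) (_ : ∀ b, Fintype (κ b)) (d : ∀ b, κ b → resField K v),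
      Fintype.card (κ false) + Fintype.card (κ true) = Fintype.card ι ∧
      ∀ n, Cap q n ↔ ∃ a : Bool → ℕ, a false + a true = n ∧ ∀ b, Cap (d b) (a b) := by
  classical
  obtain ⟨p, hp⟩ := exists_unif v hdisc
  choose e r hr hrep using fun t => exists_rep v hp (q t) (hq t)
  refine ⟨fun b => {t // e t = b}, inferInstance, fun b t => r t, ?_,
    cap_core v hdisc hcomp hchar hp q e r hrep hr⟩
  have := sum_split (K := ℚ) e (fun _ => 1)
  simp only [Finset.sum_const, Finset.card_univ, nsmul_eq_mul, mul_one] at this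
  exact_mod_cast this.symm

/-- Constructing a form over `K`. -/
lemma cap_build (hdisc : Function.Surjective v)
    (hcomp : @CompleteSpace K (Valued.mk' v).toUniformSpace)
    (hchar : ringChar (resField K v) ≠ 2)
    (κ : Bool → Type) [∀ b, Fintype (κ b)] (d : ∀ b, κ b → resField K v)
    (hd : ∀ b t, d b t ≠ 0) :
    ∃ q : (Σ b, κ b) → K,
      ∀ n, Cap q n ↔ ∃ a : Bool → ℕ, a false + a true = n ∧ ∀ b, Cap (d b) (a b) := by
  classical
  obtain ⟨p, hp⟩ := exists_unif v hdisc
  choose q hq using fun t : (Σ b, κ b) => exists_lift v (p := p) t.1 (d t.1 t.2)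
  refine ⟨q, fun n => ?_⟩
  rw [cap_core v hdisc hcomp hchar hp q Sigma.fst (fun t => d t.1 t.2) hq (fun t => hd _ _)]
  have : ∀ b m, Cap (fun t : {t : (Σ b, κ b) // t.1 = b} => d t.1.1 t.1.2) m ↔ Cap (d b) m := by
    intro b m
    constructor
    · intro h
      exact h.comp (fun t : κ b => ⟨⟨b, t⟩, rfl⟩) (by intro x y h; simpa using h)
    · intro h
      let f : {t : (Σ b, κ b) // t.1 = b} → κ b := fun t => t.2 ▸ t.1.2
      have := h.comp f (by
        rintro ⟨⟨b1, a⟩, ha⟩ ⟨⟨b2, c⟩, hc⟩ h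
        simp only at ha hc
        subst ha
        subst hc
        simpa [f] using h)
      convert this using 1
      ext ⟨⟨b', t⟩, ht⟩
      simp only at ht
      subst ht
      rfl
  simp only [this]

end CapSec

section Witt
variable {k : Type} [Field k]

lemma witt_bdd {ι : Type} [Fintype ι] (d : ι → k) :
    BddAbove {m : ℕ | ∃ (s : ℕ) (e : Fin s → k), FormIsom k d (Sum.elim (hypForm k m) e)} := by
  refine ⟨Fintype.card ι, ?_⟩
  rintro m ⟨s, e, ⟨f⟩⟩
  have := f.toLinearEquiv.finrank_eq
  simp at this
  omega

lemma not_an_of_isom {ι : Type} [Fintype ι] (d : ι → k) {m s : ℕ} (hm : 1 ≤ m) (e : Fin s → k)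
    (h : FormIsom k d (Sum.elim (hypForm k m) e)) : ¬ An d := by
  classical
  obtain ⟨f⟩ := h
  intro hA
  rw [an_iff] at hA
  let i0 : Fin (2 * m) ⊕ Fin s := Sum.inl ⟨0, by omega⟩
  let i1 : Fin (2 * m) ⊕ Fin s := Sum.inl ⟨1, by omega⟩
  have hne : i0 ≠ i1 := by simp [i0, i1]
  let x : Fin (2 * m) ⊕ Fin s → k := Pi.single i0 1 + Pi.single i1 1
  have hx : diagQF k (Sum.elim (hypForm k m) e) x = 0 := by
    rw [diagQF, QuadraticMap.weightedSumSquares_apply]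
    rw [Fintype.sum_eq_add i0 i1 hne]
    · simp [x, hne, hne.symm]
      simp [i0, i1, hypForm]
    · rintro j ⟨h0, h1⟩
      simp [x, h0, h1]
  have h1 : diagQF k d (f.symm x) = 0 := by rw [← hx]; exact f.symm.map_app x
  have h2 := hA _ h1
  have h3 : x = 0 := by
    have := congrArg f h2
    rwa [f.apply_symm_apply, map_zero] at this
  have := congrFun h3 i0
  simp [x, hne] at this

lemma exists_isom {ι : Type} [Fintype ι] (h2 : (2 : k) ≠ 0) (d : ι → k) (hd : ∀ t, d t ≠ 0)
    (hA : ¬ An d) : ∃ (s : ℕ) (e : Fin s → k), FormIsom k d (Sum.elim (hypForm k 1) e) := by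
  classical
  have : Invertible (2 : k) := invertibleOfNonzero h2
  obtain ⟨x, hx, hx0⟩ : ∃ x : ι → k, ∑ t, d t * x t ^ 2 = 0 ∧ x ≠ 0 := by
    unfold An at hA; push Not at hA; exact hA
  obtain ⟨j, hj⟩ := Function.ne_iff.mp hx0
  simp only [Pi.zero_apply] at hj
  -- the bilinear form
  let B : (ι → k) →ₗ[k] (ι → k) →ₗ[k] k :=
    LinearMap.mk₂ k (fun x y => ∑ t, d t * x t * y t)
      (by intros; simp only [Pi.add_apply, ← Finset.sum_add_distrib]; congr 1; ext; ring)
      (by intros; simp only [Pi.smul_apply, smul_eq_mul, Finset.mul_sum]; congr 1; ext; ring)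
      (by intros; simp only [Pi.add_apply, ← Finset.sum_add_distrib]; congr 1; ext; ring)
      (by intros; simp only [Pi.smul_apply, smul_eq_mul, Finset.mul_sum]; congr 1; ext; ring)
  have hB : ∀ x y, B x y = ∑ t, d t * x t * y t := fun x y => rfl
  have hBs : ∀ x y, B x y = B y x := by
    intro x y; rw [hB, hB]; congr 1; ext; ring
  have hQ : ∀ x, diagQF k d x = B x x := by
    intro x
    rw [diagQF, QuadraticMap.weightedSumSquares_apply, hB]
    congr 1; ext; simp; ring
  have hxx : B x x = 0 := by rw [hB, ← hx]; congr 1; ext; ring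
  set c := B x (Pi.single j 1) with hc
  have hc0 : c ≠ 0 := by
    rw [hc, hB, Fintype.sum_eq_single j]
    · simp [hd j, hj]
    · intro t ht; simp [ht]
  -- isotropic partner
  let g := B (Pi.single j 1) (Pi.single j 1)
  obtain ⟨y, hxy, hyy⟩ : ∃ y, B x y = c ∧ B y y = 0 := by
    refine ⟨Pi.single j 1 - (g / (2 * c)) • x, ?_, ?_⟩
    · rw [map_sub, map_smul, hxx, ← hc]; simp
    · simp only [map_sub, map_smul, LinearMap.sub_apply, LinearMap.smul_apply, hxx,
        hBs (Pi.single j 1) x, ← hc, smul_eq_mul]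
      change g - _ - _ = 0
      field_simp
      ring
  have hyx : B y x = c := by rw [hBs, hxy]
  let a := x + (1 / (2 * c)) • y
  let b := x - (1 / (2 * c)) • y
  have haa : B a a = 1 := by
    simp only [a, map_add, map_smul, LinearMap.add_apply, LinearMap.smul_apply, hxx, hxy, hyx, hyy,
      smul_eq_mul]
    field_simp; ring
  have hbb : B b b = -1 := by
    simp only [b, map_sub, map_smul, LinearMap.sub_apply, LinearMap.smul_apply, hxx, hxy, hyx, hyy,
      smul_eq_mul]
    field_simp; ring
  have hab : B a b = 0 := by
    simp only [a, b, map_add, map_sub, map_smul, LinearMap.add_apply, LinearMap.smul_apply, hxx,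
      hxy, hyx, hyy, smul_eq_mul]
    ring
  have hba : B b a = 0 := by rw [hBs, hab]
  let U : Submodule k (ι → k) := LinearMap.ker (B a) ⊓ LinearMap.ker (B b)
  obtain ⟨e, ⟨φ⟩⟩ := QuadraticForm.equivalent_weightedSumSquares ((diagQF k d).comp U.subtype)
  refine ⟨_, e, ⟨QuadraticMap.IsometryEquiv.symm ?_⟩⟩
  let i0 : Fin (2 * 1) := 0
  let i1 : Fin (2 * 1) := 1
  have hU : ∀ z : U, B a z = 0 ∧ B b z = 0 := fun z => by
    exact ⟨LinearMap.mem_ker.1 z.2.1, LinearMap.mem_ker.1 z.2.2⟩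
  have hU' : ∀ z : U, B z a = 0 ∧ B z b = 0 := fun z => by
    rw [hBs, hBs _ b]; exact hU z
  let F : (Fin (2 * 1) ⊕ Fin (Module.finrank k U) → k) →ₗ[k] (ι → k) :=
    { toFun := fun w => w (Sum.inl i0) • a + w (Sum.inl i1) • b + (φ.symm (fun t => w (Sum.inr t)) : ι → k)
      map_add' := by
        intro w w'
        have : (fun t => (w + w') (Sum.inr t)) =
          (fun t => w (Sum.inr t)) + (fun t => w' (Sum.inr t)) := rfl
        rw [this, map_add]
        simp only [Pi.add_apply, Submodule.coe_add]
        module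
      map_smul' := by
        intro r w
        have : (fun t => (r • w) (Sum.inr t)) = r • (fun t => w (Sum.inr t)) := rfl
        rw [this, map_smul]
        simp only [Pi.smul_apply, Submodule.coe_smul, RingHom.id_apply, smul_eq_mul]
        module }
  have hF : ∀ w, F w = w (Sum.inl i0) • a + w (Sum.inl i1) • b +
    (φ.symm (fun t => w (Sum.inr t)) : ι → k) := fun w => rfl
  have hFa : ∀ w, B a (F w) = w (Sum.inl i0) := by
    intro w
    rw [hF]; simp [haa, hab, (hU _).1]
  have hFb : ∀ w, B b (F w) = - w (Sum.inl i1) := by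
    intro w
    rw [hF]; simp [hbb, hba, (hU _).2]
  have hinj : Function.Injective F := by
    rw [injective_iff_map_eq_zero]
    intro w hw
    have h0 : w (Sum.inl i0) = 0 := by rw [← hFa w, hw, map_zero]
    have h1 : w (Sum.inl i1) = 0 := by
      have := hFb w
      rw [hw, map_zero] at this
      exact neg_eq_zero.mp this.symm
    rw [hF, h0, h1] at hw
    simp only [zero_smul, zero_add] at hw
    have h3 : φ.symm (fun t => w (Sum.inr t)) = 0 := Subtype.ext hw
    have h4 := congrArg φ h3
    rw [φ.apply_symm_apply, map_zero] at h4
    ext (t | t)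
    · fin_cases t
      · exact h0
      · exact h1
    · exact congrFun h4 t
  have hsurj : Function.Surjective F := by
    intro z
    have hz : z - B a z • a + B b z • b ∈ U := by
      simp [U, haa, hab, hba, hbb]
    refine ⟨Sum.elim ![B a z, - B b z] (φ ⟨_, hz⟩), ?_⟩
    rw [hF]
    simp only [Sum.elim_inr, Sum.elim_inl]
    have : φ.symm (fun t => φ ⟨_, hz⟩ t) = ⟨_, hz⟩ := φ.symm_apply_apply _
    rw [this]
    simp only [i0, i1]
    change B a z • a + (- B b z) • b + (z - B a z • a + B b z • b) = z
    module
  refine { LinearEquiv.ofBijective F ⟨hinj, hsurj⟩ with map_app' := ?_ }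
  intro w
  change diagQF k d (F w) = _
  have h5 : diagQF k d (φ.symm (fun t => w (Sum.inr t)) : ι → k) =
      ∑ t, e t • (w (Sum.inr t) * w (Sum.inr t)) := by
    have := φ.symm.map_app (fun t => w (Sum.inr t))
    rw [QuadraticMap.weightedSumSquares_apply] at this
    exact this
  rw [hQ] at h5 ⊢
  rw [diagQF, QuadraticMap.weightedSumSquares_apply, Fintype.sum_sum_type]
  simp only [Sum.elim_inr, Sum.elim_inl]
  rw [← h5, hF]
  simp only [map_add, map_smul, LinearMap.add_apply, LinearMap.smul_apply, haa, hab, hba, hbb,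
    (hU _).1, (hU _).2, (hU' _).1, (hU' _).2, smul_eq_mul]
  have h6 : ∑ t : Fin (2 * 1), hypForm k 1 t * (w (Sum.inl t) * w (Sum.inl t)) =
      w (Sum.inl i0) * w (Sum.inl i0) - w (Sum.inl i1) * w (Sum.inl i1) := by
    rw [show (∑ t : Fin (2 * 1), hypForm k 1 t * (w (Sum.inl t) * w (Sum.inl t))) =
      ∑ t : Fin 2, hypForm k 1 t * (w (Sum.inl t) * w (Sum.inl t)) from rfl, Fin.sum_univ_two]
    simp [hypForm, i0, i1]
    ring
  rw [h6]
  ring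

lemma one_le_witt {ι : Type} [Fintype ι] (h2 : (2 : k) ≠ 0) (d : ι → k) (hd : ∀ t, d t ≠ 0) :
    1 ≤ wittIndex k d ↔ ¬ An d := by
  constructor
  · intro h
    by_contra hA
    have : wittIndex k d ≤ 0 := by
      apply csSup_le'
      rintro m ⟨s, e, hm⟩
      by_contra h0
      exact not_an_of_isom d (by omega) e hm hA
    omega
  · intro h
    exact le_csSup (witt_bdd d) (exists_isom h2 d hd h)

lemma mInv_eq (h2 : (2 : k) ≠ 0) (i : ℕ) : mInv k i 1 = sInf {N : ℕ∞ | ∃ n : ℕ, N = n ∧ 1 ≤ n ∧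
    ∃ (ι : Type) (_ : Fintype ι) (d : ι → k), Fintype.card ι = n ∧ An d ∧ ¬ Cap d i} := by
  unfold mInv
  congr 1
  ext N
  simp only [Set.mem_ofPred_eq]
  refine exists_congr fun n => and_congr_right fun _ => and_congr_right fun _ => ?_
  constructor
  · rintro ⟨d, hd, hw, h⟩
    have hA : An d := by
      by_contra hA
      have := (one_le_witt h2 d hd).2 hA
      omega
    refine ⟨Fin n, inferInstance, d, by simp, hA, fun hC => ?_⟩
    obtain ⟨σ, hσ⟩ := hC.fin
    exact (one_le_witt h2 _ hσ.ne).1 (h σ fun t => hσ.ne (Sum.inr t)) hσ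
  · rintro ⟨ι, _, d, hc, hA, hC⟩
    let f := (Fintype.equivFinOfCardEq hc)
    have hA' := hA.comp f.symm f.symm.injective
    refine ⟨d ∘ f.symm, hA'.ne, ?_, ?_⟩
    · have := (one_le_witt h2 _ hA'.ne).not.2 (not_not.2 hA')
      omega
    · intro σ hσ
      rw [one_le_witt h2]
      · intro hB
        have hC' : Cap (d ∘ f.symm) i := ⟨Fin i, inferInstance, σ, by simp, hB⟩
        have := hC'.comp f f.injective
        rw [Function.comp_assoc, f.symm_comp_self, Function.comp_id] at this
        exact hC this
      · rintro (t | t)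
        exacts [hA'.ne t, hσ t]

end Witt

section Main
variable {K : Type} [Field K] (v : Valuation K Zm0)

lemma two_ne_K (hchar : ringChar (resField K v) ≠ 2) : (2 : K) ≠ 0 := by
  intro h
  apply two_ne v hchar
  have h1 : (2 : v.valuationSubring) = 0 := by
    apply Subtype.ext
    exact h
  have := congrArg (IsLocalRing.residue v.valuationSubring) h1
  rwa [map_ofNat, map_zero] at this

lemma upper (hdisc : Function.Surjective v)
    (hcomp : @CompleteSpace K (Valued.mk' v).toUniformSpace)
    (hchar : ringChar (resField K v) ≠ 2) (i : ℕ)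
    (κ : Bool → Type) [∀ b, Fintype (κ b)] (d : ∀ b, κ b → resField K v)
    (hd : ∀ b, An (d b)) (hpos : 1 ≤ Fintype.card (κ false) + Fintype.card (κ true))
    (h : ∀ a : Bool → ℕ, a false + a true = i → (∀ b, Cap (d b) (a b)) → False) :
    mInv K i 1 ≤ ((Fintype.card (κ false) + Fintype.card (κ true) : ℕ) : ℕ∞) := by
  rw [mInv_eq (two_ne_K v hchar)]
  obtain ⟨q, hq⟩ := cap_build v hdisc hcomp hchar κ d fun b t => (hd b).ne t
  refine sInf_le ⟨_, rfl, hpos, _, inferInstance, q, ?_, ?_, ?_⟩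
  · rw [Fintype.card_sigma]; simp [add_comm]
  · exact ((hq 0).2 ⟨fun _ => 0, rfl, fun b => (hd b).cap⟩).an
  · rw [hq]
    rintro ⟨a, ha, hb⟩
    exact h a ha hb

lemma mInv_le {k : Type} [Field k] (h2 : (2 : k) ≠ 0) {ι : Type} [Fintype ι] {d : ι → k}
    (hd : An d) (hpos : 1 ≤ Fintype.card ι) {i : ℕ} (h : ¬ Cap d i) :
    mInv k i 1 ≤ ((Fintype.card ι : ℕ) : ℕ∞) := by
  rw [mInv_eq h2]
  exact sInf_le ⟨_, rfl, hpos, ι, inferInstance, d, rfl, hd, h⟩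

/-- the largest extension dimension -/
lemma exists_cap_max {k : Type} [Field k] {u : ℕ} (hu : uInv k = (u : ℕ∞)) {ι : Type} [Fintype ι]
    {d : ι → k} (hd : An d) : ∃ f : ℕ, Cap d f ∧ (∀ a, Cap d a → a ≤ f) ∧ Fintype.card ι + f ≤ u := by
  classical
  have hb : ∀ a, Cap d a → a ≤ u := fun a ha => by have := ha.card_le hu; omega
  refine ⟨Nat.findGreatest (Cap d) u, ?_, fun a ha => Nat.le_findGreatest (hb a ha) ha, ?_⟩
  · exact Nat.findGreatest_spec (Nat.zero_le _) hd.cap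
  · exact (Nat.findGreatest_spec (P := Cap d) (Nat.zero_le u) hd.cap).card_le hu

end Main

end S19

/-- **Proposition (refined m-invariants of a complete discretely valued field, large
`i`).**  Let `K` be a complete discretely valued field (with normalized, i.e. surjective,
discrete valuation `v`) with residue field `k` of characteristic ≠ 2 such that
`u(k) = u < ∞`.  If `i` is any integer with `u(k) < i < u(K)`, then `m_{i,1}(K)` is the
minimum over `⌈i/2⌉ ≤ s ≤ u(k)` of the quantities `m_{s,1}(k) + m_{i-s+1,1}(k)` and
`m_{i-u(k),1}(k)`.  (Here `⌈i/2⌉ = (i+1)/2` in natural number arithmetic.) -/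
theorem statement19 (K : Type) [Field K] (v : Valuation K Zm0)
    (hdisc : Function.Surjective v)
    (hcomp : @CompleteSpace K (Valued.mk' v).toUniformSpace)
    (hchar : ringChar (resField K v) ≠ 2)
    (u : ℕ) (hu : uInv (resField K v) = (u : ℕ∞))
    (i : ℕ) (h1 : u < i) (h2 : (i : ℕ∞) < uInv K) :
    mInv K i 1 =
      min (mInv (resField K v) (i - u) 1)
        (⨅ s ∈ Finset.Icc ((i + 1) / 2) u,
          (mInv (resField K v) s 1 + mInv (resField K v) (i - s + 1) 1)) := by
  classical
  have h2k : (2 : resField K v) ≠ 0 := S19.two_ne v hchar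
  have h2K : (2 : K) ≠ 0 := S19.two_ne_K v hchar
  have hi2 : i < 2 * u := by
    obtain ⟨N, ⟨n, rfl, d, hd, hA⟩, hN⟩ := lt_sSup_iff.1 h2
    have hn : i < n := by exact_mod_cast hN
    rw [← S19.an_iff] at hA
    obtain ⟨κ, _, e, hc, he⟩ := S19.cap_decomp v hdisc hcomp hchar d hd
    obtain ⟨a, -, ha⟩ := (he 0).1 hA.cap
    have h3 := (ha false).card_le hu
    have h4 := (ha true).card_le hu
    rw [Fintype.card_fin] at hc
    omega
  apply le_antisymm
  · refine le_min ?_ (le_iInf₂ fun s hs => ?_)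
    · rw [S19.mInv_eq h2k]
      refine le_sInf ?_
      rintro N ⟨n, rfl, hn, ι, _, d, hc, hA, hC⟩
      have hE : S19.An (Fin.elim0 : Fin 0 → resField K v) := fun x _ => Subsingleton.elim _ _
      let _ : ∀ b : Bool, Fintype ((fun b => Bool.rec ι (Fin 0) b : Bool → Type) b) :=
        fun b => match b with
          | false => (inferInstance : Fintype ι)
          | true => (inferInstance : Fintype (Fin 0))
      have := S19.upper v hdisc hcomp hchar i (fun b => Bool.rec ι (Fin 0) b)
        (fun b => Bool.rec d Fin.elim0 b) (by rintro (_ | _); exacts [hA, hE])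
        (by change 1 ≤ Fintype.card ι + Fintype.card (Fin 0); omega) ?_
      · refine this.trans (le_of_eq ?_)
        change ((Fintype.card ι + Fintype.card (Fin 0) : ℕ) : ℕ∞) = _
        rw [hc, Fintype.card_fin, add_zero]
      · intro a ha hb
        have h3 := (hb true).card_le hu
        exact hC ((hb false).anti (by omega))
    · rw [Finset.mem_Icc] at hs
      have hatt : ∀ j, mInv (resField K v) j 1 ≠ ⊤ → ∃ n : ℕ, mInv (resField K v) j 1 = n ∧ 1 ≤ n ∧
          ∃ (ι : Type) (_ : Fintype ι) (d : ι → resField K v),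
            Fintype.card ι = n ∧ S19.An d ∧ ¬ S19.Cap d j := by
        intro j hj
        rw [S19.mInv_eq h2k] at hj ⊢
        generalize hT : {N : ℕ∞ | ∃ n : ℕ, N = n ∧ 1 ≤ n ∧
          ∃ (ι : Type) (_ : Fintype ι) (d : ι → resField K v),
            Fintype.card ι = n ∧ S19.An d ∧ ¬ S19.Cap d j} = T at hj ⊢
        have hne : T.Nonempty := Set.nonempty_iff_ne_empty.2 fun hem => hj (by rw [hem, sInf_empty])
        have hmem := csInf_mem hne
        rw [← hT] at hmem ⊢
        exact hmem
      by_cases ht1 : mInv (resField K v) s 1 = ⊤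
      · rw [ht1, top_add]; exact le_top
      by_cases ht2 : mInv (resField K v) (i - s + 1) 1 = ⊤
      · rw [ht2, add_top]; exact le_top
      obtain ⟨n, hn, hn1, ι, _, d, hc, hA, hC⟩ := hatt _ ht1
      obtain ⟨n', hn', hn1', ι', _, d', hc', hA', hC'⟩ := hatt _ ht2
      rw [hn, hn']
      let _ : ∀ b : Bool, Fintype ((fun b => Bool.rec ι ι' b : Bool → Type) b) :=
        fun b => match b with
          | false => (inferInstance : Fintype ι)
          | true => (inferInstance : Fintype ι')
      have := S19.upper v hdisc hcomp hchar i (fun b => Bool.rec ι ι' b)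
        (fun b => Bool.rec d d' b) (by rintro (_ | _); exacts [hA, hA'])
        (by change 1 ≤ Fintype.card ι + Fintype.card ι'; omega) ?_
      · refine this.trans (le_of_eq ?_)
        change ((Fintype.card ι + Fintype.card ι' : ℕ) : ℕ∞) = _
        rw [hc, hc']
        push_cast
        rfl
      · intro a ha hb
        by_cases has : s ≤ a false
        · exact hC ((hb false).anti has)
        · exact hC' ((hb true).anti (by omega))
  · rw [S19.mInv_eq h2K]
    refine le_sInf ?_
    rintro N ⟨n, rfl, hn, ι, _, q, hc, hA, hC⟩
    obtain ⟨κ, _, d, hcard, he⟩ := S19.cap_decomp v hdisc hcomp hchar q hA.ne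
    obtain ⟨a, -, ha⟩ := (he 0).1 hA.cap
    have hd : ∀ b, S19.An (d b) := fun b => (ha b).an
    choose f hf1 hf2 hf3 using fun b => S19.exists_cap_max hu (hd b)
    have hsum : f false + f true < i := by
      by_contra hlt
      push Not at hlt
      refine hC ((he i).2 ⟨fun b => if b then i - min i (f false) else min i (f false), ?_, ?_⟩)
      · simp
      · rintro (_ | _)
        · exact (hf1 false).anti (by simp)
        · exact (hf1 true).anti (by simp; omega)
    have hno : ∀ b m, f b < m → ¬ S19.Cap (d b) m := fun b m hm hcap => by
      have := hf2 b m hcap; omega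
    rw [← hc, ← hcard]
    have hempty : ∀ b, Fintype.card (κ b) = 0 → f b = u := by
      intro b hb
      have : IsEmpty (κ b) := Fintype.card_eq_zero_iff.1 hb
      have h3 := hf2 b u (S19.cap_empty hu (d b))
      have := hf3 b
      omega
    have hone : ∀ b, Fintype.card (κ (!b)) = 0 → 
        mInv (resField K v) (i - u) 1 ≤ ((Fintype.card (κ b) : ℕ) : ℕ∞) := by
      intro b hb
      have h3 := hempty _ hb
      apply S19.mInv_le h2k (hd b)
      · rw [← hc, ← hcard] at hn
        cases b <;> simp at hb <;> omega
      · apply hno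
        cases b <;> simp at h3 <;> omega
    have htwo : ∀ b, 1 ≤ Fintype.card (κ b) → 1 ≤ Fintype.card (κ (!b)) → f (!b) ≤ f b →
        (⨅ s ∈ Finset.Icc ((i + 1) / 2) u,
          (mInv (resField K v) s 1 + mInv (resField K v) (i - s + 1) 1)) ≤
        ((Fintype.card (κ b) : ℕ) : ℕ∞) + ((Fintype.card (κ (!b)) : ℕ) : ℕ∞) := by
      intro b hb hb' hle
      have h3 := hf3 b
      have hs : f b + f (!b) < i := by cases b <;> simp <;> omega
      refine (iInf₂_le (max (f b + 1) ((i + 1) / 2)) (Finset.mem_Icc.2 ⟨by omega, by omega⟩)).trans ?_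
      exact add_le_add (S19.mInv_le h2k (hd b) hb (hno _ _ (by omega)))
        (S19.mInv_le h2k (hd _) hb' (hno _ _ (by omega)))
    rcases Nat.eq_zero_or_pos (Fintype.card (κ false)) with h0 | h0
    · refine (min_le_left _ _).trans ((hone true h0).trans ?_)
      exact_mod_cast Nat.le_add_left _ _
    rcases Nat.eq_zero_or_pos (Fintype.card (κ true)) with h1' | h1'
    · refine (min_le_left _ _).trans ((hone false h1').trans ?_)
      exact_mod_cast Nat.le_add_right _ _
    refine (min_le_right _ _).trans ?_
    push_cast
    rcases le_total (f true) (f false) with hle | hle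
    · exact htwo false h0 h1' hle
    · exact (htwo true h1' h0 hle).trans (le_of_eq (add_comm _ _))
end
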